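/- There exists a C^∞ μ-preserving diffeomorphism T of the torus T² such that the set B of all generic points of T for the Lebesgue measure μ satisfies log 2 / log 3 ≤ dim_H(B) ≤ 1 + log 2 / log 3 and μ(B) = 0, where dim_H denotes Hausdorff dimension. -/

import Mathlib

open MeasureTheory Filter Topology
open scoped ENNReal
noncomputable section

abbrev Torus2 := UnitAddCircle × UnitAddCircle

/-- Canonical projection `ℝ² → 𝕋²`. -/
def torusProj : ℝ × ℝ → Torus2 := fun p => ((p.1 : UnitAddCircle), (p.2 : UnitAddCircle))

/-- `F : ℝ² → ℝ²` is a lift of `f : 𝕋² → 𝕋²`. -/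
def IsLift (F : ℝ × ℝ → ℝ × ℝ) (f : Torus2 → Torus2) : Prop :=
  ∀ p : ℝ × ℝ, torusProj (F p) = f (torusProj p)

/-- `F` commutes with integer translations. -/
def IntEquivariant (F : ℝ × ℝ → ℝ × ℝ) : Prop :=
  ∀ p : ℝ × ℝ, ∀ m : ℤ × ℤ, F (p + ((m.1 : ℝ), (m.2 : ℝ))) = F p + ((m.1 : ℝ), (m.2 : ℝ))

/-- A C^∞ measure-preserving diffeomorphism of the torus 𝕋². -/
structure SmoothMPTorusDiffeo where
  toEquiv : Torus2 ≃ Torus2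
  lift : ℝ × ℝ → ℝ × ℝ
  liftInv : ℝ × ℝ → ℝ × ℝ
  lift_contDiff : ContDiff ℝ (⊤ : ℕ∞) lift
  liftInv_contDiff : ContDiff ℝ (⊤ : ℕ∞) liftInv
  lift_equivariant : IntEquivariant lift
  liftInv_equivariant : IntEquivariant liftInv
  lift_isLift : IsLift lift toEquiv
  liftInv_isLift : IsLift liftInv toEquiv.symm
  measurePreserving : MeasurePreserving toEquiv volume volume

/-- generic point -/
def IsGenericPt (T : Torus2 → Torus2) (ν : Measure Torus2) (x : Torus2) : Prop :=
  ∀ f : C(Torus2, ℝ),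
    Tendsto (fun N : ℕ => (N : ℝ)⁻¹ * ∑ i ∈ Finset.range N, f (T^[i] x)) atTop
      (𝓝 (∫ y, f y ∂ν))

def IsMinimalMap (T : Torus2 → Torus2) : Prop :=
  ∀ x : Torus2, Dense (Set.range fun n : ℕ => T^[n] x)

def IsWeakMixingWrt (T : Torus2 → Torus2) (ν : Measure Torus2) : Prop :=
  ∃ m : ℕ → ℕ, StrictMono m ∧ ∀ A B : Set Torus2, MeasurableSet A → MeasurableSet B →
    Tendsto (fun n => |(ν (B ∩ (T^[m n]) ⁻¹' A)).toReal - (ν A).toReal * (ν B).toReal|)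
      atTop (𝓝 0)

/-- Lift of the translation `S_t`. -/
def Slift (t : ℝ) : ℝ × ℝ → ℝ × ℝ := fun p => (p.1 + t, p.2)


/-- Periodicity under `ℤ²`. -/
def Per (f : ℝ × ℝ → ℝ) : Prop :=
  ∀ p : ℝ × ℝ, ∀ m : ℤ × ℤ, f (p + ((m.1 : ℝ), (m.2 : ℝ))) = f p

/-- Mean of a periodic function. -/
def I2 (f : ℝ × ℝ → ℝ) : ℝ := ∫ x in (0 : ℝ)..1, ∫ y in (0 : ℝ)..1, f (x, y)

/-- Lifts of smooth area preserving torus diffeomorphisms. -/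
structure Lft where
  F : ℝ × ℝ → ℝ × ℝ
  G : ℝ × ℝ → ℝ × ℝ
  hF : ContDiff ℝ (⊤ : ℕ∞) F
  hG : ContDiff ℝ (⊤ : ℕ∞) G
  eF : IntEquivariant F
  eG : IntEquivariant G
  FG : ∀ p, F (G p) = p
  GF : ∀ p, G (F p) = p
  mp : ∀ f : ℝ × ℝ → ℝ, Continuous f → Per f → I2 (fun p => f (F p)) = I2 f

lemma Per.comp {f : ℝ × ℝ → ℝ} (hf : Per f) {F : ℝ × ℝ → ℝ × ℝ} (hF : IntEquivariant F) :
    Per (fun p => f (F p)) := by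
  intro p m
  simp only [hF p m, hf (F p) m]

def Lft.comp (A B : Lft) : Lft where
  F := fun p => A.F (B.F p)
  G := fun p => B.G (A.G p)
  hF := A.hF.comp B.hF
  hG := B.hG.comp A.hG
  eF := fun p m => by beta_reduce; rw [B.eF p m, A.eF]
  eG := fun p m => by beta_reduce; rw [A.eG p m, B.eG]
  FG := fun p => by simp only [B.FG, A.FG]
  GF := fun p => by simp only [B.GF, A.GF]
  mp := fun f hf pf => by
    rw [B.mp (fun p => f (A.F p)) (hf.comp A.hF.continuous) (pf.comp A.eF), A.mp f hf pf]

lemma I2_G (A : Lft) (f : ℝ × ℝ → ℝ) (hf : Continuous f) (pf : Per f) :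
    I2 (fun p => f (A.G p)) = I2 f := by
  rw [← A.mp (fun p => f (A.G p)) (hf.comp A.hG.continuous) (pf.comp A.eG)]
  simp only [A.GF]

def Lft.inv (A : Lft) : Lft where
  F := A.G
  G := A.F
  hF := A.hG
  hG := A.hF
  eF := A.eG
  eG := A.eF
  FG := A.GF
  GF := A.FG
  mp := I2_G A

lemma per_shift (f : ℝ → ℝ) (hf : Function.Periodic f 1) (t : ℝ) :
    ∫ x in (0:ℝ)..1, f (x + t) = ∫ x in (0:ℝ)..1, f x := by
  rw [intervalIntegral.integral_comp_add_right]
  have := hf.intervalIntegral_add_eq t 0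
  simpa [add_comm] using this

lemma Per.fst {f : ℝ × ℝ → ℝ} (hf : Per f) (y : ℝ) : Function.Periodic (fun x => f (x, y)) 1 := by
  intro x
  have := hf (x, y) (1, 0)
  simpa using this

lemma Per.snd {f : ℝ × ℝ → ℝ} (hf : Per f) (x : ℝ) : Function.Periodic (fun y => f (x, y)) 1 := by
  intro y
  have := hf (x, y) (0, 1)
  simpa using this

lemma I2_swap (f : ℝ × ℝ → ℝ) (hf : Continuous f) :
    I2 f = ∫ y in (0 : ℝ)..1, ∫ x in (0 : ℝ)..1, f (x, y) := by
  unfold I2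
  apply MeasureTheory.intervalIntegral_intervalIntegral_swap
  exact (hf.continuousOn.integrableOn_compact (isCompact_uIcc.prod isCompact_uIcc)).mono_set
    (Set.prod_mono Set.uIoc_subset_uIcc Set.uIoc_subset_uIcc) 

def vshear (c : ℝ → ℝ) (hc : ContDiff ℝ (⊤ : ℕ∞) c) (pc : Function.Periodic c 1) : Lft where
  F := fun p => (p.1, p.2 + c p.1)
  G := fun p => (p.1, p.2 - c p.1)
  hF := by fun_prop
  hG := by fun_prop
  eF := fun p m => by
    have := pc.int_mul m.1 p.1
    simp only [mul_one] at this
    ext <;> simp [this]; ring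
  eG := fun p m => by
    have := pc.int_mul m.1 p.1
    simp only [mul_one] at this
    ext <;> simp [this]; ring
  FG := fun p => by ext <;> simp
  GF := fun p => by ext <;> simp
  mp := fun f hf pf => by
    unfold I2
    congr 1; ext x
    exact per_shift _ (pf.snd x) (c x)

def hshear (c : ℝ → ℝ) (hc : ContDiff ℝ (⊤ : ℕ∞) c) (pc : Function.Periodic c 1) : Lft where
  F := fun p => (p.1 + c p.2, p.2)
  G := fun p => (p.1 - c p.2, p.2)
  hF := by fun_prop
  hG := by fun_prop
  eF := fun p m => by
    have := pc.int_mul m.2 p.2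
    simp only [mul_one] at this
    ext <;> simp [this]; ring
  eG := fun p m => by
    have := pc.int_mul m.2 p.2
    simp only [mul_one] at this
    ext <;> simp [this]; ring
  FG := fun p => by ext <;> simp
  GF := fun p => by ext <;> simp
  mp := fun f hf pf => by
    rw [I2_swap _ hf, I2_swap _ (by have := hc.continuous; fun_prop)]
    congr 1; ext y
    exact per_shift _ (pf.fst y) (c y)

def hTrans (t : ℝ) : Lft := hshear (fun _ => t) contDiff_const (fun _ => rfl)

def Lft.id : Lft := hTrans 0

@[simp] lemma hTrans_F (t : ℝ) (p : ℝ × ℝ) : (hTrans t).F p = (p.1 + t, p.2) := rfl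
@[simp] lemma hTrans_G (t : ℝ) (p : ℝ × ℝ) : (hTrans t).G p = (p.1 - t, p.2) := rfl

/-- reduce to the unit square -/
lemma exists_unit (p : ℝ × ℝ) : ∃ p0 : ℝ × ℝ, ∃ m : ℤ × ℤ, p0 ∈ Set.Icc (0:ℝ) 1 ×ˢ Set.Icc (0:ℝ) 1 ∧
    p = p0 + ((m.1 : ℝ), (m.2 : ℝ)) := by
  refine ⟨(Int.fract p.1, Int.fract p.2), (⌊p.1⌋, ⌊p.2⌋), ⟨⟨Int.fract_nonneg _, (Int.fract_lt_one _).le⟩,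
    ⟨Int.fract_nonneg _, (Int.fract_lt_one _).le⟩⟩, ?_⟩
  ext <;> simp

lemma equiv_lipschitz {F : ℝ × ℝ → ℝ × ℝ} (hF : ContDiff ℝ (⊤ : ℕ∞) F) (eF : IntEquivariant F) :
    ∃ L : NNReal, LipschitzWith L F := by
  have hc : Continuous (fun p => ‖fderiv ℝ F p‖₊) := (hF.continuous_fderiv (by simp)).nnnorm
  have hK : IsCompact (Set.Icc (0:ℝ) 1 ×ˢ Set.Icc (0:ℝ) 1) := isCompact_Icc.prod isCompact_Icc
  obtain ⟨L, hL⟩ := (hK.image hc).bddAbove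
  refine ⟨L, lipschitzWith_of_nnnorm_fderiv_le (hF.differentiable (by simp)) ?_⟩
  intro p
  obtain ⟨p0, m, hp0, rfl⟩ := exists_unit p
  have h1 : fderiv ℝ F (p0 + ((m.1 : ℝ), (m.2 : ℝ))) = fderiv ℝ F p0 := by
    rw [← fderiv_comp_add_right]
    have : (fun x => F (x + ((m.1 : ℝ), (m.2 : ℝ)))) = fun x => F x + ((m.1 : ℝ), (m.2 : ℝ)) := by
      ext1 x; exact eF x m
    rw [this, fderiv_add_const]
  rw [h1]
  exact hL ⟨p0, hp0, rfl⟩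

/-- Common Lipschitz constant. -/
lemma Lft.lip (A : Lft) : ∃ L : ℝ, 1 ≤ L ∧ (∀ p p', dist (A.F p) (A.F p') ≤ L * dist p p') ∧
    (∀ p p', dist (A.G p) (A.G p') ≤ L * dist p p') := by
  obtain ⟨L1, h1⟩ := equiv_lipschitz A.hF A.eF
  obtain ⟨L2, h2⟩ := equiv_lipschitz A.hG A.eG
  refine ⟨1 + L1 + L2, ?_, ?_, ?_⟩
  · have := L1.2; have := L2.2
    simp only [NNReal.val_eq_coe] at *; linarith
  · intro p p'
    refine (h1.dist_le_mul p p').trans ?_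
    have := L1.2; have := L2.2
    simp only [NNReal.val_eq_coe] at *
    apply mul_le_mul_of_nonneg_right _ dist_nonneg
    linarith
  · intro p p'
    refine (h2.dist_le_mul p p').trans ?_
    have := L1.2; have := L2.2
    simp only [NNReal.val_eq_coe] at *
    apply mul_le_mul_of_nonneg_right _ dist_nonneg
    linarith

/-- conjugate of a translation -/
def cnj (A : Lft) (t : ℝ) : Lft := A.comp ((hTrans t).comp A.inv)

lemma cnj_F (A : Lft) (t : ℝ) (p : ℝ × ℝ) : (cnj A t).F p = A.F (A.G p + (t, 0)) := by
  change A.F ((A.G p).1 + t, (A.G p).2) = _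
  congr 1
  ext <;> simp

lemma cnj_G (A : Lft) (t : ℝ) (p : ℝ × ℝ) : (cnj A t).G p = A.F (A.G p + (-t, 0)) := by
  change A.F ((A.G p).1 - t, (A.G p).2) = _
  congr 1
  ext <;> simp; ring

lemma cnj_iter (A : Lft) (t : ℝ) (p : ℝ × ℝ) (j : ℕ) :
    (cnj A t).F^[j] p = A.F (A.G p + (j * t, 0)) := by
  induction j with
  | zero =>
    have : A.G p + (((0:ℕ):ℝ) * t, 0) = A.G p := by ext <;> simp
    rw [this, A.FG]; rfl
  | succ k ih =>
    rw [Function.iterate_succ_apply', ih, cnj_F, A.GF]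
    congr 1
    ext <;> simp; ring

/-- `C^k` continuity of the conjugates -/
lemma cnj_close (A : Lft) (a : ℝ) (k : ℕ) (ε : ℝ) (hε : 0 < ε) :
    ∀ᶠ t in 𝓝 a, ∀ p, ‖iteratedFDeriv ℝ k (fun p => A.F (A.G p + (t, 0)) - A.F (A.G p + (a, 0))) p‖ ≤ ε := by
  set Φ : ℝ × (ℝ × ℝ) → ℝ × ℝ := fun z => A.F (A.G z.2 + (z.1, 0)) with hΦ
  have hA := A.hF
  have hB := A.hG
  have hΦs : ContDiff ℝ (⊤ : ℕ∞) Φ := by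
    apply hA.comp
    fun_prop
  set ι : (ℝ × ℝ) →L[ℝ] ℝ × (ℝ × ℝ) := ContinuousLinearMap.inr ℝ ℝ (ℝ × ℝ)
  have key : ∀ t p, iteratedFDeriv ℝ k (fun p => A.F (A.G p + (t, 0))) p =
      (iteratedFDeriv ℝ k Φ (t, p)).compContinuousLinearMap (fun _ => ι) := by
    intro t p
    have h1 : (fun p => A.F (A.G p + (t, 0))) = (fun z => Φ (z + (t, 0))) ∘ ι := by
      ext1 p; simp [Φ, ι]
    rw [h1, ContinuousLinearMap.iteratedFDeriv_comp_right (n := (⊤ : ℕ∞)) ι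
      (by apply hΦs.comp; fun_prop) p (by exact_mod_cast le_top), iteratedFDeriv_comp_add_right]
    simp [ι]
  have hcont : Continuous (fun z => iteratedFDeriv ℝ k Φ z) :=
    hΦs.continuous_iteratedFDeriv (by exact_mod_cast le_top)
  set c : ℝ := 1 + ∏ _i : Fin k, ‖ι‖ with hc
  have hcpos : 0 < c := by
    have : 0 ≤ ∏ _i : Fin k, ‖ι‖ := Finset.prod_nonneg (fun _ _ => norm_nonneg _)
    linarith
  have hK : IsCompact (Set.Icc (0:ℝ) 1 ×ˢ Set.Icc (0:ℝ) 1) := isCompact_Icc.prod isCompact_Icc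
  have hev : ∀ᶠ t in 𝓝 a, ∀ p ∈ Set.Icc (0:ℝ) 1 ×ˢ Set.Icc (0:ℝ) 1,
      ‖iteratedFDeriv ℝ k Φ (t, p) - iteratedFDeriv ℝ k Φ (a, p)‖ < ε / c := by
    apply hK.eventually_forall_of_forall_eventually
    intro p _
    have hc2 : Continuous (fun z : ℝ × (ℝ × ℝ) =>
        ‖iteratedFDeriv ℝ k Φ (z.1, z.2) - iteratedFDeriv ℝ k Φ (a, z.2)‖) := by
      apply Continuous.norm
      apply Continuous.sub
      · exact hcont.comp (by fun_prop)
      · exact hcont.comp (by fun_prop)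
    have := hc2.tendsto (a, p)
    simp only [sub_self, norm_zero] at this
    exact this.eventually (gt_mem_nhds (by positivity))
  filter_upwards [hev] with t ht p
  have hs : ∀ t, ContDiff ℝ (⊤ : ℕ∞) (fun p => A.F (A.G p + (t, 0))) := by
    intro t
    apply hA.comp; fun_prop
  obtain ⟨p0, m, hp0, rfl⟩ := exists_unit p
  have hper : (fun p => A.F (A.G (p + ((m.1 : ℝ), (m.2 : ℝ))) + (t, 0)) -
      A.F (A.G (p + ((m.1 : ℝ), (m.2 : ℝ))) + (a, 0))) =
      fun p => A.F (A.G p + (t, 0)) - A.F (A.G p + (a, 0)) := by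
    ext1 p
    rw [A.eG, add_right_comm, A.eF, add_right_comm, A.eF, add_sub_add_right_eq_sub]
  rw [← iteratedFDeriv_comp_add_right, hper]
  have hsub : iteratedFDeriv ℝ k (fun p => A.F (A.G p + (t, 0)) - A.F (A.G p + (a, 0))) p0 =
     (iteratedFDeriv ℝ k Φ (t, p0) - iteratedFDeriv ℝ k Φ (a, p0)).compContinuousLinearMap (fun _ => ι) := by
    have h1 := iteratedFDeriv_sub_apply (i := k) (x := p0) (𝕜 := ℝ)
      ((hs t).of_le (by exact_mod_cast le_top)).contDiffAt
      ((hs a).of_le (by exact_mod_cast le_top)).contDiffAt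
    have h2 : (fun p => A.F (A.G p + (t, 0)) - A.F (A.G p + (a, 0))) =
      (fun p => A.F (A.G p + (t, 0))) - (fun p => A.F (A.G p + (a, 0))) := rfl
    rw [h2, h1, key, key]
    ext v <;> simp
  rw [hsub]
  refine (ContinuousMultilinearMap.norm_compContinuousLinearMap_le _ _).trans ?_
  have h3 := (ht p0 hp0).le
  calc _ ≤ (ε / c) * c := by
        apply mul_le_mul h3 _ _ (by positivity)
        · linarith
        · exact Finset.prod_nonneg (fun _ _ => norm_nonneg _)
    _ = ε := by field_simp


/-- A smooth bump on an interval. -/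
lemma exists_bump (a a' b' b : ℝ) (h1 : a < a') (h2 : b' < b) :
    ∃ χ : ℝ → ℝ, ContDiff ℝ (⊤ : ℕ∞) χ ∧ (∀ x, 0 ≤ χ x) ∧ (∀ x, χ x ≤ 1) ∧
      (∀ x, a' ≤ x → x ≤ b' → χ x = 1) ∧ (∀ x, x ≤ a → χ x = 0) ∧ (∀ x, b ≤ x → χ x = 0) := by
  have e1 : 0 < a' - a := by linarith
  have e2 : 0 < b - b' := by linarith
  refine ⟨fun x => Real.smoothTransition ((x - a) / (a' - a)) * Real.smoothTransition ((b - x) / (b - b')),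
    ?_, ?_, ?_, ?_, ?_, ?_⟩
  · apply ContDiff.mul
    · exact Real.smoothTransition.contDiff.comp (by fun_prop)
    · exact Real.smoothTransition.contDiff.comp (by fun_prop)
  · intro x; exact mul_nonneg (Real.smoothTransition.nonneg _) (Real.smoothTransition.nonneg _)
  · intro x; exact mul_le_one₀ (Real.smoothTransition.le_one _) (Real.smoothTransition.nonneg _) (Real.smoothTransition.le_one _)
  · intro x hx hx'
    dsimp only
    rw [Real.smoothTransition.one_of_one_le, Real.smoothTransition.one_of_one_le, one_mul]
    · rw [le_div_iff₀ e2]; linarith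
    · rw [le_div_iff₀ e1]; linarith
  · intro x hx
    dsimp only
    rw [Real.smoothTransition.zero_of_nonpos, zero_mul]
    exact div_nonpos_of_nonpos_of_nonneg (by linarith) e1.le
  · intro x hx
    dsimp only
    rw [Real.smoothTransition.zero_of_nonpos (x := (b - x) / (b - b')), mul_zero]
    exact div_nonpos_of_nonpos_of_nonneg (by linarith) e2.le

/-- Smooth periodic extension. -/
lemma per_ext (f : ℝ → ℝ) (hf : ContDiff ℝ (⊤ : ℕ∞) f) (ε : ℝ) (hε : 0 < ε)
    (h0 : ∀ x, x ≤ ε → f x = 0) (h1 : ∀ x, 1 - ε ≤ x → f x = 0) :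
    ContDiff ℝ (⊤ : ℕ∞) (fun x => f (Int.fract x)) := by
  rw [contDiff_iff_contDiffAt]
  intro x
  by_cases hx : Int.fract x = 0
  · have : (fun x => f (Int.fract x)) =ᶠ[𝓝 x] fun _ => 0 := by
      have hx' : x = ⌊x⌋ := by
        have := Int.floor_add_fract x; rw [hx] at this; linarith
      have hm : Set.Ioo (x - min ε 1) (x + min ε 1) ∈ 𝓝 x :=
        Ioo_mem_nhds (by simp [hε]) (by simp [hε])
      filter_upwards [hm] with y hy
      have m1 := min_le_left ε 1
      have m2 := min_le_right ε 1
      obtain ⟨hy1, hy2⟩ := hy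
      rcases le_or_gt x y with h | h
      · apply h0
        have : ⌊y⌋ = ⌊x⌋ := by
          rw [Int.floor_eq_iff]; constructor <;> linarith
        have h3 := Int.self_sub_floor y
        rw [← h3, this]; linarith
      · apply h1
        have : ⌊y⌋ = ⌊x⌋ - 1 := by
          rw [Int.floor_eq_iff]; push_cast; constructor <;> linarith
        have h3 := Int.self_sub_floor y
        rw [← h3, this]; push_cast; linarith
    exact contDiffAt_const.congr_of_eventuallyEq this
  · have hpos : 0 < Int.fract x := lt_of_le_of_ne (Int.fract_nonneg x) (Ne.symm hx)
    have hlt := Int.fract_lt_one x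
    have h3 := Int.self_sub_floor x
    have : (fun x => f (Int.fract x)) =ᶠ[𝓝 x] fun y => f (y - ⌊x⌋) := by
      have hm : Set.Ioo (⌊x⌋ : ℝ) (⌊x⌋ + 1) ∈ 𝓝 x := Ioo_mem_nhds (by linarith) (by linarith)
      filter_upwards [hm] with y hy
      have : ⌊y⌋ = ⌊x⌋ := by
        rw [Int.floor_eq_iff]; exact ⟨hy.1.le, hy.2⟩
      rw [← Int.self_sub_floor y, this]
    refine ContDiffAt.congr_of_eventuallyEq ?_ this
    exact (hf.comp (by fun_prop : ContDiff ℝ (⊤ : ℕ∞) (fun y : ℝ => y - ⌊x⌋))).contDiffAt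

lemma fract_per (f : ℝ → ℝ) : Function.Periodic (fun x => f (Int.fract x)) 1 := by
  intro x; simp

lemma exists_B (w : ℝ) (hw : 0 < w) (hw' : w < 1 / 16) :
    ∃ B : ℝ → ℝ, ContDiff ℝ (⊤ : ℕ∞) B ∧ Function.Periodic B 1 ∧ (∀ x, 0 ≤ B x) ∧ (∀ x, B x ≤ 1) ∧
      (∀ x, 2 * w ≤ x → x ≤ 1 / 2 - w → B x = x) ∧
      (∀ x, 1 / 2 ≤ x → x ≤ 1 - 2 * w → B x = (1 - w) * (1 - x)) := by
  obtain ⟨χ, c1, c2, c3, c4, c5, c6⟩ := exists_bump w (2*w) (1/2-w) (1/2-w/2) (by linarith) (by linarith)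
  obtain ⟨ξ, d1, d2, d3, d4, d5, d6⟩ := exists_bump (1/2-w/2) (1/2) (1-2*w) (1-w) (by linarith) (by linarith)
  set f : ℝ → ℝ := fun x => x * χ x + (1 - w) * (1 - x) * ξ x with hf
  have key : ∀ x, 0 ≤ x → x ≤ 1 → 0 ≤ f x ∧ f x ≤ 1 := by
    intro x h0 h1
    rcases le_total x (1/2-w/2) with h | h
    · have e : f x = x * χ x := by simp [hf, d5 x h]
      rw [e]
      exact ⟨mul_nonneg h0 (c2 x), mul_le_one₀ h1 (c2 x) (c3 x)⟩
    · have e : f x = (1 - w) * (1 - x) * ξ x := by simp [hf, c6 x h]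
      have e1 : (1 - w) * (1 - x) ≤ 1 := by nlinarith
      have e2 : 0 ≤ (1 - w) * (1 - x) := mul_nonneg (by linarith) (by linarith)
      rw [e]
      exact ⟨mul_nonneg e2 (d2 x), mul_le_one₀ e1 (d2 x) (d3 x)⟩
  refine ⟨fun x => f (Int.fract x), per_ext f (by fun_prop) w hw ?_ ?_, fract_per f, ?_, ?_, ?_, ?_⟩
  · intro x hx; simp [hf, c5 x hx, d5 x (by linarith)]
  · intro x hx; simp [hf, c6 x (by linarith), d6 x hx]
  · intro x; exact (key _ (Int.fract_nonneg x) (Int.fract_lt_one x).le).1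
  · intro x; exact (key _ (Int.fract_nonneg x) (Int.fract_lt_one x).le).2
  · intro x h1 h2
    dsimp only
    rw [Int.fract_eq_self.2 ⟨by linarith, by linarith⟩]
    simp [hf, c4 x h1 h2, d5 x (by linarith)]
  · intro x h1 h2
    dsimp only
    rw [Int.fract_eq_self.2 ⟨by linarith, by linarith⟩]
    simp [hf, d4 x h1 h2, c6 x (by linarith)]

lemma exists_c0 (w : ℝ) (hw : 0 < w) (hw' : w < 1 / 16) :
    ∃ B : ℝ → ℝ, ContDiff ℝ (⊤ : ℕ∞) B ∧ Function.Periodic B 1 ∧ (∀ x, -1 ≤ B x) ∧ (∀ x, B x ≤ 0) ∧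
      (∀ x, 4 * w ≤ x → x ≤ 1 - 2 * w → B x = - (x / 2)) := by
  obtain ⟨χ, c1, c2, c3, c4, c5, c6⟩ := exists_bump w (4*w) (1-2*w) (1-w) (by linarith) (by linarith)
  set f : ℝ → ℝ := fun x => - (x / 2) * χ x with hf
  refine ⟨fun x => f (Int.fract x), per_ext f (by fun_prop) w hw ?_ ?_, fract_per f, ?_, ?_, ?_⟩
  · intro x hx; simp [hf, c5 x hx]
  · intro x hx; simp [hf, c6 x hx]
  · intro x
    have := Int.fract_nonneg x; have := (Int.fract_lt_one x).le
    have := c2 (Int.fract x); have := c3 (Int.fract x)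
    simp only [hf]; nlinarith
  · intro x
    have := Int.fract_nonneg x; have := (Int.fract_lt_one x).le
    have := c2 (Int.fract x); have := c3 (Int.fract x)
    simp only [hf]; nlinarith
  · intro x h1 h2
    dsimp only
    rw [Int.fract_eq_self.2 ⟨by linarith, by linarith⟩]
    simp [hf, c4 x h1 h2]

lemma exists_c1 (w : ℝ) (hw : 0 < w) (hw' : w < 1 / 16) :
    ∃ B : ℝ → ℝ, ContDiff ℝ (⊤ : ℕ∞) B ∧ Function.Periodic B 1 ∧
      (∀ x, 0 ≤ x → x ≤ 1 - 2 * w → B x = 0) ∧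
      (∀ x, 1 - w ≤ x → x ≤ 1 - 2 * w ^ 2 → B x = x - 1) := by
  have hw2 : 0 < w ^ 2 := by positivity
  have hw3 : w ^ 2 ≤ w / 16 := by nlinarith
  obtain ⟨χ, c1, c2, c3, c4, c5, c6⟩ := exists_bump (1-2*w) (1-w) (1-2*w^2) (1-w^2) (by linarith) (by linarith)
  set f : ℝ → ℝ := fun x => (x - 1) * χ x with hf
  refine ⟨fun x => f (Int.fract x), per_ext f (by fun_prop) (w^2) hw2 ?_ ?_, fract_per f, ?_, ?_⟩
  · intro x hx; simp [hf, c5 x (by linarith)]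
  · intro x hx; simp [hf, c6 x hx]
  · intro x h1 h2
    dsimp only
    rw [Int.fract_eq_self.2 ⟨by linarith, by linarith⟩]
    simp [hf, c5 x h2]
  · intro x h1 h2
    dsimp only
    rw [Int.fract_eq_self.2 ⟨by linarith, by linarith⟩]
    simp [hf, c4 x h1 h2]

lemma exists_a (d : ℝ) (hd : 0 < d) (hd' : d ≤ 1 / 64) :
    ∃ a : ℝ → ℝ, ContDiff ℝ (⊤ : ℕ∞) a ∧ Function.Periodic a 1 ∧
      (∀ x : ℝ, 1 / 2 ≤ x → x ≤ 1 / 2 + d → a x = (x - 1 / 2) / d) ∧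
      (∀ x : ℝ, (∀ k : ℤ, 2 * d ≤ |x - 1 / 2 - k|) → a x = 0) := by
  obtain ⟨χ, c1, c2, c3, c4, c5, c6⟩ := exists_bump (1/2-2*d) (1/2-d) (1/2+d) (1/2+2*d) (by linarith) (by linarith)
  set f : ℝ → ℝ := fun x => (x - 1/2) / d * χ x with hf
  refine ⟨fun x => f (Int.fract x), per_ext f (by fun_prop) d hd ?_ ?_, fract_per f, ?_, ?_⟩
  · intro x hx; simp [hf, c5 x (by linarith)]
  · intro x hx; simp [hf, c6 x (by linarith)]
  · intro x h1 h2
    dsimp only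
    rw [Int.fract_eq_self.2 ⟨by linarith, by linarith⟩]
    simp only [hf]
    rw [c4 x (by linarith) h2, mul_one]
  · intro x h
    have h3 := h ⌊x⌋
    have h4 := Int.self_sub_floor x
    have h5 : x - 1/2 - ⌊x⌋ = Int.fract x - 1/2 := by linarith
    rw [h5] at h3
    simp only [hf]
    rcases le_abs.1 h3 with h6 | h6
    · rw [c6 _ (by linarith), mul_zero]
    · rw [c5 _ (by linarith), mul_zero]

lemma per_fract {B : ℝ → ℝ} (hB : Function.Periodic B 1) (x : ℝ) : B (Int.fract x) = B x := by
  have := hB.sub_int_mul_eq (x := x) ⌊x⌋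
  rw [mul_one, Int.self_sub_floor] at this
  exact this

lemma per_scale {B : ℝ → ℝ} (hB : Function.Periodic B 1) (q : ℕ) (hq : 0 < q) (x : ℝ) (r : ℤ) :
    B (q * (x + r / q)) = B (q * x) := by
  have h0 : (q : ℝ) ≠ 0 := by positivity
  have : (q : ℝ) * (x + r / q) = q * x + r * 1 := by field_simp
  rw [this]; exact hB.int_mul r _

lemma exists_h (q : ℕ) (hq : 0 < q) (w d K : ℝ) (hw : 0 < w) (hw' : w < 1 / 16)
    (hd : 0 < d) (hd' : d ≤ 1 / 64) :
    ∃ h : Lft, (∀ P : ℝ × ℝ, ∀ r : ℤ, h.F (P + ((r / q : ℝ), 0)) = h.F P + ((r / q : ℝ), 0)) ∧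
    (∃ U : ℝ → ℝ, Continuous U ∧ Function.Periodic U 1 ∧
      (∀ x : ℝ, |(h.F (x, 1 / 2)).2 - (1 / 2 + U ((q:ℝ) * x))| ≤ d) ∧
      (∀ x : ℝ, 2 * w ≤ x → x ≤ 1 / 2 - w → U x = 0) ∧
      (∀ x : ℝ, 1 / 2 ≤ x → x ≤ 1 - 2 * w → U x = K * w * (x - 1))) ∧
    (∀ x : ℝ, 4 * w ≤ Int.fract ((q:ℝ) * x) → Int.fract ((q:ℝ) * x) ≤ 1 - 2 * w →
      h.F ((x + ⌊(q:ℝ) * x⌋ / q) / 2, 1 / 2) = (x, 1 / 2)) ∧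
    (∀ P : ℝ × ℝ, 4 * w ≤ Int.fract ((q:ℝ) * P.1) → Int.fract ((q:ℝ) * P.1) ≤ 1 - 2 * w →
      (∀ k : ℤ, 8 * d ≤ |P.2 - 1 / 2 - k|) → ∀ x : ℝ, 4 * w ≤ Int.fract ((q:ℝ) * x) → Int.fract ((q:ℝ) * x) ≤ 1 - 2 * w →
        (h.F (x, (h.G P).2)).1 = x ∧ |(h.F (x, (h.G P).2)).2 - P.2| ≤ 4 * d) := by
  have hq0 : (q : ℝ) ≠ 0 := by positivity
  have hqp : (0 : ℝ) < q := by positivity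
  obtain ⟨B, B1, B2, B3, B4, B5, B6⟩ := exists_B w hw hw'
  obtain ⟨c0, C1, C2, C3, C4, C5⟩ := exists_c0 w hw hw'
  obtain ⟨c1, D1, D2, D3, D4⟩ := exists_c1 w hw hw'
  obtain ⟨a, A1, A2, A3, A4⟩ := exists_a d hd hd'
  have hper : ∀ {f : ℝ → ℝ}, Function.Periodic f 1 → ∀ x, f (q * (x + 1)) = f (q * x) := by
    intro f hf x
    have := per_scale hf q hq x q
    rwa [Int.cast_natCast, div_self hq0] at this
  set b : ℝ → ℝ := fun x => d * B (q * x) with hb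
  set c : ℝ → ℝ := fun x => d * c0 (q * x) + K * c1 (q * x) with hc
  have hbs : ContDiff ℝ (⊤ : ℕ∞) b := contDiff_const.mul (B1.comp (by fun_prop))
  have hcs : ContDiff ℝ (⊤ : ℕ∞) c :=
    (contDiff_const.mul (C1.comp (by fun_prop))).add (contDiff_const.mul (D1.comp (by fun_prop)))
  have hbp : Function.Periodic b 1 := fun x => by simp only [hb, hper B2]
  have hcp : Function.Periodic c 1 := fun x => by simp only [hc, hper C2, hper D2]
  have hbq : ∀ x (r : ℤ), b (x + r / q) = b x := fun x r => by simp only [hb, per_scale B2 q hq]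
  have hcq : ∀ x (r : ℤ), c (x + r / q) = c x := fun x r => by
    simp only [hc, per_scale C2 q hq, per_scale D2 q hq]
  set a' : ℝ → ℝ := fun y => a y / q with ha'
  have ha's : ContDiff ℝ (⊤ : ℕ∞) a' := A1.div_const _
  have ha'p : Function.Periodic a' 1 := fun x => by simp only [ha', A2 x]
  set h : Lft := (vshear c hcs hcp).comp ((hshear a' ha's ha'p).comp (vshear b hbs hbp)) with hh
  have hF : ∀ x y, h.F (x, y) = (x + a' (y + b x), y + b x + c (x + a' (y + b x))) := fun x y => rfl
  have hG : ∀ x y, h.G (x, y) = (x - a' (y - c x), y - c x - b (x - a' (y - c x))) := fun x y => rfl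
  have hb0 : ∀ x, 0 ≤ b x ∧ b x ≤ d := by
    intro x
    have := B3 (q * x); have := B4 (q * x)
    constructor
    · simp only [hb]; positivity
    · simp only [hb]; nlinarith
  have hline : ∀ x, q * (x + a' (1 / 2 + b x)) = q * x + B (q * x) := by
    intro x
    simp only [ha']
    rw [A3 _ (by linarith [(hb0 x).1]) (by linarith [(hb0 x).2])]
    simp only [hb]
    field_simp; ring
  have hcsmall : ∀ x : ℝ, 4 * w ≤ Int.fract (q * x) → Int.fract (q * x) ≤ 1 - 2 * w → -d ≤ c x ∧ c x ≤ 0 := by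
    intro x h1 h2
    have e : c x = d * c0 (q * x) := by
      simp only [hc]
      rw [← per_fract D2, D3 _ (Int.fract_nonneg _) h2]; ring
    have := C3 (q * x); have := C4 (q * x)
    rw [e]; constructor <;> nlinarith
  refine ⟨h, ?_, ⟨fun θ => K * c1 (θ + B θ), ?_, ?_, ?_, ?_, ?_⟩, ?_, ?_⟩
  · rintro ⟨x, y⟩ r
    have e1 : ((x, y) : ℝ × ℝ) + ((r / q : ℝ), 0) = (x + r / q, y) := by ext <;> simp
    rw [e1, hF, hF, hbq]
    have e2 : x + (r : ℝ) / q + a' (y + b x) = (x + a' (y + b x)) + r / q := by ring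
    rw [e2, hcq]
    ext <;> simp
  · exact continuous_const.mul (D1.continuous.comp (continuous_id.add B1.continuous))
  · intro θ
    dsimp only
    rw [B2 θ]
    have : θ + 1 + B θ = θ + B θ + 1 := by ring
    rw [this, D2]
  · intro x
    rw [hF]
    dsimp only
    simp only [hc]
    rw [hline]
    have := B3 (q * x); have := B4 (q * x)
    have := C3 (q * x + B (q * x)); have := C4 (q * x + B (q * x))
    simp only [hb]
    rw [abs_le]; constructor <;> nlinarith
  · intro x h1 h2
    dsimp only
    rw [B5 x h1 h2, D3 _ (by linarith) (by linarith), mul_zero]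
  · intro x h1 h2
    dsimp only
    have e : x + B x = 1 - w * (1 - x) := by rw [B6 x h1 h2]; ring
    rw [e, D4 _ (by nlinarith) (by nlinarith)]; ring
  · intro x h1 h2
    set z := (x + ⌊q * x⌋ / q) / 2 with hz
    have hfl := Int.self_sub_floor (q * x)
    have hz1 : q * z = Int.fract (q * x) / 2 + ⌊q * x⌋ := by
      rw [hz]; field_simp; linarith
    have hBz : B (q * z) = Int.fract (q * x) / 2 := by
      have := B2.int_mul ⌊q * x⌋ (Int.fract (q * x) / 2)
      rw [mul_one] at this
      rw [hz1, this, B5 _ (by linarith) (by linarith)]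
    have hX : z + a' (1 / 2 + b z) = x := by
      have := hline z
      rw [hBz, hz1] at this
      have h5 : (q : ℝ) * (z + a' (1 / 2 + b z)) = q * x := by rw [this]; linarith
      exact mul_left_cancel₀ hq0 h5
    rw [hF, hX]
    have hcx : c x = - (d * (Int.fract (q * x) / 2)) := by
      simp only [hc]
      rw [← per_fract D2, D3 _ (Int.fract_nonneg _) h2, ← per_fract C2, C5 _ h1 h2]; ring
    have hbz : b z = d * (Int.fract (q * x) / 2) := by simp only [hb, hBz]
    rw [hcx, hbz]
    ext <;> simp
  · rintro ⟨X, Y⟩ h1 h2 h3 x h4 h5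
    dsimp only at h1 h2 h3 ⊢
    have hcX := hcsmall X h1 h2
    have hcx := hcsmall x h4 h5
    have az : ∀ y, |y - Y| ≤ 6 * d → a' y = 0 := by
      intro y hy
      simp only [ha']
      rw [A4 y, zero_div]
      intro k
      have := h3 k
      have e : Y - 1/2 - k = (y - 1/2 - k) - (y - Y) := by ring
      rw [e] at this
      have := abs_sub (y - 1/2 - k) (y - Y)
      linarith
    have e1 : a' (Y - c X) = 0 := az _ (by rw [abs_le]; constructor <;> linarith [hcX.1, hcX.2])
    have hbX := hb0 X
    have hbx := hb0 x
    rw [hG, e1, sub_zero]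
    dsimp only
    rw [hF, az _ (by rw [abs_le]; constructor <;> linarith [hcX.1, hcX.2, hbX.1, hbX.2, hbx.1, hbx.2]), add_zero]
    refine ⟨rfl, ?_⟩
    dsimp only
    rw [abs_le]; constructor <;> linarith [hcX.1, hcX.2, hbX.1, hbX.2, hbx.1, hbx.2, hcx.1, hcx.2]


/-- Riemann sums. -/
lemma riemann_sum (G : ℝ → ℝ) (hG : Continuous G) (δ ω : ℝ) (hδ : 0 < δ)
    (h : ∀ s t, |s - t| ≤ δ → |G s - G t| ≤ ω) (x : ℝ) (M : ℕ) :
    |δ * ∑ i ∈ Finset.range M, G (x + i * δ) - ∫ t in x..(x + M * δ), G t| ≤ M * δ * ω := by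
  induction M with
  | zero => simp
  | succ M ih =>
    have h1 : |δ * G (x + M * δ) - ∫ t in (x + M * δ)..(x + (M + 1 : ℕ) * δ), G t| ≤ ω * δ := by
      have e1 : δ * G (x + M * δ) = ∫ t in (x + M * δ)..(x + (M + 1 : ℕ) * δ), G (x + M * δ) := by
        rw [intervalIntegral.integral_const, smul_eq_mul]; push_cast; ring
      rw [e1, ← intervalIntegral.integral_sub (by simp) (hG.intervalIntegrable _ _)]
      have := intervalIntegral.norm_integral_le_of_norm_le_const (a := x + M * δ)
        (b := x + (M + 1 : ℕ) * δ) (C := ω) (f := fun t => G (x + M * δ) - G t) (by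
          intro t ht
          push_cast at ht
          rw [Set.uIoc_of_le (by linarith)] at ht
          apply h
          rw [abs_le]; constructor <;> linarith [ht.1, ht.2])
      rw [Real.norm_eq_abs] at this
      refine this.trans (le_of_eq ?_)
      push_cast
      have : x + (M + 1) * δ - (x + M * δ) = δ := by ring
      rw [this, abs_of_pos hδ]
    rw [Finset.sum_range_succ, ← intervalIntegral.integral_add_adjacent_intervals
      (hG.intervalIntegrable x (x + M * δ)) (hG.intervalIntegrable _ _)]
    have e : δ * (∑ i ∈ Finset.range M, G (x + i * δ) + G (x + M * δ)) -
        ((∫ t in x..(x + M * δ), G t) + ∫ t in (x + M * δ)..(x + (M + 1 : ℕ) * δ), G t) =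
        (δ * ∑ i ∈ Finset.range M, G (x + i * δ) - ∫ t in x..(x + M * δ), G t) +
        (δ * G (x + M * δ) - ∫ t in (x + M * δ)..(x + (M + 1 : ℕ) * δ), G t) := by ring
    rw [e]
    refine (abs_add_le _ _).trans ?_
    push_cast at *
    linarith

lemma sum_coprime (G : ℝ → ℝ) (hp : Function.Periodic G 1) (q p : ℕ) (hq : 0 < q)
    (hpq : Nat.Coprime p q) (x : ℝ) :
    ∑ r ∈ Finset.range q, G (x + r * (p / q)) = ∑ r ∈ Finset.range q, G (x + r * (1 / q)) := by
  have hq0 : (q : ℝ) ≠ 0 := by positivity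
  have hmaps : Set.MapsTo (fun r => (r * p) % q) (Finset.range q : Set ℕ) (Finset.range q) := by
    intro r _
    simpa using Nat.mod_lt _ hq
  have hinj : Set.InjOn (fun r => (r * p) % q) (Finset.range q : Set ℕ) := by
    intro a ha b hb hab
    have : a * p ≡ b * p [MOD q] := hab
    have := Nat.ModEq.cancel_right_of_coprime (by rw [Nat.coprime_comm] at hpq; exact hpq) this
    simp at ha hb
    rwa [Nat.ModEq, Nat.mod_eq_of_lt ha, Nat.mod_eq_of_lt hb] at this
  refine Finset.sum_nbij (fun r => (r * p) % q) hmaps hinj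
    (Finset.surjOn_of_injOn_of_card_le _ hmaps hinj le_rfl) ?_
  intro r _
  have h1 : (r * p : ℝ) = ((r * p) % q : ℕ) + q * ((r * p) / q : ℕ) := by
    exact_mod_cast (Nat.mod_add_div (r * p) q).symm
  have h2 : x + r * ((p : ℝ) / q) = x + ((r * p) % q : ℕ) * (1 / q) + ((r * p) / q : ℕ) * 1 := by
    have : r * ((p : ℝ) / q) = (r * p) / q := by ring
    rw [this, h1]; field_simp
    ring
  rw [h2, hp.nat_mul]

lemma riemann_coprime (G : ℝ → ℝ) (hG : Continuous G) (hp : Function.Periodic G 1) (q p : ℕ) (hq : 0 < q)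
    (hpq : Nat.Coprime p q) (ω : ℝ) (h : ∀ s t, |s - t| ≤ 1 / (q : ℝ) → |G s - G t| ≤ ω) (x : ℝ) :
    |(1 / (q : ℝ)) * ∑ r ∈ Finset.range q, G (x + r * (p / q)) - ∫ t in (0:ℝ)..1, G t| ≤ ω := by
  have hq0 : (q : ℝ) ≠ 0 := by positivity
  have h1 := riemann_sum G hG (1 / q) ω (by positivity) h x q
  rw [sum_coprime G hp q p hq hpq]
  have e : (q : ℝ) * (1 / q) = 1 := by field_simp
  rw [e, one_mul] at h1
  have := hp.intervalIntegral_add_eq x 0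
  rw [zero_add] at this
  rw [← this]; exact h1

/-- integral of a mean zero periodic function -/
lemma per_int_bound (G : ℝ → ℝ) (hG : Continuous G) (hp : Function.Periodic G 1) (C : ℝ)
    (hC : ∀ x, |G x| ≤ C) (h0 : ∫ t in (0:ℝ)..1, G t = 0) (a b : ℝ) : |∫ t in a..b, G t| ≤ C := by
  have h1 : ∀ n : ℤ, ∫ t in a..(a + n), G t = 0 := by
    intro n
    have := hp.intervalIntegral_add_zsmul_eq n a (fun _ _ => hG.intervalIntegrable _ _)
    have h2 := hp.intervalIntegral_add_eq a 0
    rw [zero_add] at h2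
    rw [zsmul_eq_mul, mul_one, h2, h0] at this
    simpa using this
  have hC0 : 0 ≤ C := (abs_nonneg _).trans (hC 0)
  rw [← intervalIntegral.integral_add_adjacent_intervals
      (hG.intervalIntegrable a (a + ⌊b - a⌋)) (hG.intervalIntegrable _ _), h1, zero_add]
  have := intervalIntegral.norm_integral_le_of_norm_le_const (a := a + ⌊b - a⌋) (b := b) (C := C) (f := G)
    (fun t _ => hC t)
  rw [Real.norm_eq_abs] at this
  refine this.trans ?_
  have h3 : b - (a + ⌊b - a⌋) = Int.fract (b - a) := by
    rw [← Int.self_sub_floor]; ring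
  rw [h3, abs_of_nonneg (Int.fract_nonneg _)]
  have := (Int.fract_lt_one (b - a)).le
  nlinarith

/-- Subinterval bound property. -/
def SB (W : ℝ → ℝ) (e a b σ : ℝ) : Prop := ∀ s t, a ≤ s → s ≤ t → t ≤ b → |∫ x in s..t, W x| ≤ e * (t - s) + σ

lemma SB.merge {W : ℝ → ℝ} (hW : Continuous W) {e a b c σ τ : ℝ} (hσ : 0 ≤ σ) (hτ : 0 ≤ τ)
    (h1 : SB W e a b σ) (h2 : SB W e b c τ) : SB W e a c (σ + τ) := by
  intro s t hs hst ht
  rcases le_total t b with h | h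
  · have := h1 s t hs hst h; linarith
  · rcases le_total b s with h' | h'
    · have := h2 s t h' hst ht; linarith
    · have i1 := h1 s b hs h' le_rfl
      have i2 := h2 b t le_rfl h ht
      rw [← intervalIntegral.integral_add_adjacent_intervals
        (hW.intervalIntegrable s b) (hW.intervalIntegrable _ _)]
      refine (abs_add_le _ _).trans ?_
      linarith

lemma SB.trivial {W : ℝ → ℝ} {e a b C : ℝ} (he : 0 ≤ e) (hC : ∀ x, |W x| ≤ C) :
    SB W e a b (C * (b - a)) := by
  intro s t hs hst ht
  have hC0 : 0 ≤ C := (abs_nonneg _).trans (hC 0)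
  have := intervalIntegral.norm_integral_le_of_norm_le_const (a := s) (b := t) (C := C) (f := W)
    (fun t _ => hC t)
  rw [Real.norm_eq_abs, abs_of_nonneg (sub_nonneg.2 hst)] at this
  nlinarith [mul_nonneg he (sub_nonneg.2 hst)]

lemma SB.const {W : ℝ → ℝ} {e a b : ℝ} (h : ∀ x, a ≤ x → x ≤ b → |W x| ≤ e) :
    SB W e a b 0 := by
  intro s t hs hst ht
  have := intervalIntegral.norm_integral_le_of_norm_le_const (a := s) (b := t) (C := e) (f := W)
    (fun x hx => by
      rw [Set.uIoc_of_le hst] at hx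
      exact h x (by linarith [hx.1]) (by linarith [hx.2]))
  rw [Real.norm_eq_abs, abs_of_nonneg (sub_nonneg.2 hst)] at this
  linarith

lemma SB.osc {W G : ℝ → ℝ} {e a b C κ c : ℝ} (he : 0 ≤ e) (hκ : 0 < κ) (hG : Continuous G)
    (hp : Function.Periodic G 1) (hC : ∀ x, |G x| ≤ C) (h0 : ∫ t in (0:ℝ)..1, G t = 0)
    (h : ∀ x, a ≤ x → x ≤ b → W x = G (κ * x + c)) : SB W e a b (C / κ) := by
  intro s t hs hst ht
  have e1 : ∫ x in s..t, W x = ∫ x in s..t, G (κ * x + c) := by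
    apply intervalIntegral.integral_congr
    intro x hx
    rw [Set.uIcc_of_le hst] at hx
    exact h x (by linarith [hx.1]) (by linarith [hx.2])
  rw [e1, intervalIntegral.integral_comp_mul_add _ hκ.ne', smul_eq_mul, abs_mul, abs_of_pos (inv_pos.2 hκ)]
  have := per_int_bound G hG hp C hC h0 (κ * s + c) (κ * t + c)
  have h3 : κ⁻¹ * |∫ x in κ * s + c..κ * t + c, G x| ≤ κ⁻¹ * C :=
    mul_le_mul_of_nonneg_left this (inv_pos.2 hκ).le
  rw [div_eq_inv_mul]
  nlinarith [mul_nonneg he (sub_nonneg.2 hst)]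

lemma SB.per {W : ℝ → ℝ} (hp : Function.Periodic W 1) {e σ : ℝ} (h : SB W e 0 1 σ) (n : ℕ) :
    SB W e n (n + 1) σ := by
  intro s t hs hst ht
  have e1 : ∫ x in s..t, W x = ∫ x in (s - n)..(t - n), W x := by
    have := intervalIntegral.integral_comp_add_right (a := s - n) (b := t - n) W (n : ℝ)
    simp only [sub_add_cancel] at this
    rw [← this]
    congr 1; ext x
    have := hp.nat_mul n x
    rw [mul_one] at this; exact this
  rw [e1]
  have := h (s - n) (t - n) (by linarith) (by linarith) (by linarith)
  have e2 : t - n - (s - n) = t - s := by ring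
  rwa [e2] at this

lemma SB.per' {W : ℝ → ℝ} (hW : Continuous W) (hp : Function.Periodic W 1) {e σ : ℝ} (hσ : 0 ≤ σ)
    (h : SB W e 0 1 σ) (n : ℕ) : SB W e 0 (n + 1 : ℕ) ((n + 1 : ℕ) * σ) := by
  induction n with
  | zero => simpa using h
  | succ n ih =>
    have := ih.merge hW (by positivity) hσ (by simpa using h.per hp (n + 1))
    push_cast at *
    have e : ((n:ℝ) + 1) * σ + σ = (n + 1 + 1) * σ := by ring
    rw [e] at this; exact this

/-- Main one dimensional averaging lemma. -/
lemma osc_main (W G : ℝ → ℝ) (hW : Continuous W) (hWp : Function.Periodic W 1) (hG : Continuous G)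
    (hGp : Function.Periodic G 1) (C e w κ g η : ℝ) (hC : 0 ≤ C) (he : 0 ≤ e) (hw : 0 < w) (hw' : w < 1 / 16)
    (hg : 0 < g) (hg1 : g ≤ 1) (hη : 0 < η) (hwg : 80 * w ≤ g * η) (hκ : 32 ≤ κ * (g * η)) 
    (hWC : ∀ x, |W x| ≤ 2 * C) (hGC : ∀ x, |G x| ≤ 2 * C) (hG0 : ∫ t in (0:ℝ)..1, G t = 0)
    (hpl : ∀ x, 2 * w ≤ x → x ≤ 1 / 2 - w → |W x| ≤ e)
    (hos : ∀ x, 1 / 2 ≤ x → x ≤ 1 - 2 * w → W x = G (κ * (x - 1))) :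
    (∀ θ T, 2 * w ≤ θ → θ ≤ 1 / 2 - w - g → 0 ≤ T → |∫ t in θ..(θ + T), W t| ≤ (e + C * η) * T) ∧
    |∫ t in (0:ℝ)..1, W t| ≤ e / 2 + C * η := by
  have hgη : 0 < g * η := by positivity
  have hκ0 : 0 < κ := by
    by_contra h
    push Not at h
    nlinarith
  have hpl' : SB W e (2 * w) (1 / 2 - w) 0 := SB.const hpl
  have hos' : ∀ x, 1 / 2 ≤ x → x ≤ 1 - 2 * w → W x = G (κ * x + (-κ)) := by
    intro x h1 h2; rw [hos x h1 h2]; congr 1; ring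
  have key : SB W e 0 1 (C * (g * η) / 4) := by
    have h1 : SB W e 0 (2 * w) _ := SB.trivial he hWC
    have h2 : SB W e (1/2-w) (1/2) _ := SB.trivial he hWC
    have h3 : SB W e (1/2) (1-2*w) _ := SB.osc he hκ0 hG hGp hGC hG0 hos'
    have h4 : SB W e (1-2*w) 1 _ := SB.trivial he hWC
    have p1 : 0 ≤ 2 * C * (2 * w - 0) := by simp only [sub_zero]; positivity
    have p2 : 0 ≤ 2 * C * (1 / 2 - (1 / 2 - w)) := by
      have : 1 / 2 - (1 / 2 - w) = w := by ring
      rw [this]; positivity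
    have p3 : 0 ≤ 2 * C / κ := by positivity
    have p4 : 0 ≤ 2 * C * (1 - (1 - 2 * w)) := by
      have : 1 - (1 - 2 * w) = 2 * w := by ring
      rw [this]; positivity
    have h5 := (((h1.merge hW p1 le_rfl hpl').merge hW (by positivity) p2 h2).merge hW (by positivity) p3 h3).merge hW
      (by positivity) p4 h4
    intro s t hs hst ht
    refine (h5 s t hs hst ht).trans ?_
    have : 2 * C / κ ≤ C * (g * η) / 16 := by
      rw [div_le_iff₀ hκ0]; nlinarith
    nlinarith
  have hσ : 0 ≤ C * (g * η) / 4 := by positivity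
  constructor
  · intro θ T h1 h2 hT
    rcases le_total (θ + T) (1/2 - w) with h3 | h3
    · have := hpl' θ (θ + T) h1 (by linarith) h3
      have e1 : θ + T - θ = T := by ring
      rw [e1] at this
      have : 0 ≤ C * η * T := by positivity
      linarith
    · have hTg : g ≤ T := by linarith
      obtain ⟨n, hn⟩ : ∃ n : ℕ, n = ⌈T⌉₊ := ⟨_, rfl⟩
      have hn1 : T ≤ n := hn ▸ Nat.le_ceil T
      have hn2 : (n : ℝ) < T + 1 := hn ▸ Nat.ceil_lt_add_one hT
      have := key.per' hW hWp hσ n θ (θ + T) (by linarith) (by linarith) (by push_cast; linarith)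
      have e1 : θ + T - θ = T := by ring
      rw [e1] at this
      push_cast at this
      have h5 : ((n:ℝ) + 1) * g ≤ 3 * T := by nlinarith
      have h6 : ((n:ℝ) + 1) * (C * (g * η) / 4) = (((n:ℝ) + 1) * g) * (C * η / 4) := by ring
      have h7 : (((n:ℝ) + 1) * g) * (C * η / 4) ≤ (3 * T) * (C * η / 4) :=
        mul_le_mul_of_nonneg_right h5 (by positivity)
      have h8 : 0 ≤ C * η * T := by positivity
      nlinarith
  · have i1 := hpl' (2*w) (1/2-w) le_rfl (by linarith) le_rfl
    have i2 : SB W 0 0 (2*w) _ := SB.trivial le_rfl hWC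
    have i3 : SB W 0 (1/2-w) (1/2) _ := SB.trivial le_rfl hWC
    have i4 : SB W 0 (1/2) (1-2*w) _ := SB.osc le_rfl hκ0 hG hGp hGC hG0 hos'
    have i5 : SB W 0 (1-2*w) 1 _ := SB.trivial le_rfl hWC
    have j2 := i2 0 (2*w) le_rfl (by linarith) le_rfl
    have j3 := i3 _ _ le_rfl (by linarith) le_rfl
    have j4 := i4 _ _ le_rfl (by linarith) le_rfl
    have j5 := i5 _ _ le_rfl (by linarith) le_rfl
    rw [← intervalIntegral.integral_add_adjacent_intervals
        (hW.intervalIntegrable 0 (2*w)) (hW.intervalIntegrable _ _),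
      ← intervalIntegral.integral_add_adjacent_intervals
        (hW.intervalIntegrable (2*w) (1/2-w)) (hW.intervalIntegrable _ 1),
      ← intervalIntegral.integral_add_adjacent_intervals
        (hW.intervalIntegrable (1/2-w) (1/2)) (hW.intervalIntegrable _ 1),
      ← intervalIntegral.integral_add_adjacent_intervals
        (hW.intervalIntegrable (1/2) (1-2*w)) (hW.intervalIntegrable _ 1)]
    have k1 : 2 * C / κ ≤ C * (g * η) / 16 := by
      rw [div_le_iff₀ hκ0]; nlinarith
    have k2 : g * η ≤ η := by nlinarith
    have k3 : C * (g * η) ≤ C * η := mul_le_mul_of_nonneg_left k2 hC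
    have k4 : C * (80 * w) ≤ C * (g * η) := mul_le_mul_of_nonneg_left hwg hC
    rw [abs_le] at *
    constructor <;> nlinarith [j2.1, j2.2, j3.1, j3.2, j4.1, j4.2, j5.1, j5.2, i1.1, i1.2, mul_nonneg he hw.le]


lemma dist_pair (a b c d : ℝ) : dist ((a, b) : ℝ × ℝ) (c, d) = max |a - c| |b - d| := by
  rw [Prod.dist_eq, Real.dist_eq, Real.dist_eq]

lemma abs_integral01_le (f : ℝ → ℝ) (C : ℝ) (hC : ∀ x, |f x| ≤ C) : |∫ x in (0:ℝ)..1, f x| ≤ C := by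
  have := intervalIntegral.norm_integral_le_of_norm_le_const (a := (0:ℝ)) (b := 1) (C := C) (f := f)
    (fun t _ => hC t)
  simpa using this

lemma abs_integral01_sub_le (f g : ℝ → ℝ) (hf : Continuous f) (hg : Continuous g) (C : ℝ)
    (hC : ∀ x, |f x - g x| ≤ C) :
    |(∫ x in (0:ℝ)..1, f x) - ∫ x in (0:ℝ)..1, g x| ≤ C := by
  rw [← intervalIntegral.integral_sub (hf.intervalIntegrable _ _) (hg.intervalIntegrable _ _)]
  exact abs_integral01_le _ C hC

lemma integral_per_scale (V : ℝ → ℝ) (hV : Continuous V) (hp : Function.Periodic V 1) (q : ℕ) (hq : 0 < q) :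
    ∫ x in (0:ℝ)..1, V (q * x) = ∫ x in (0:ℝ)..1, V x := by
  have hq0 : (q : ℝ) ≠ 0 := by positivity
  rw [intervalIntegral.integral_comp_mul_left _ hq0]
  have := hp.intervalIntegral_add_zsmul_eq q 0 (fun _ _ => hV.intervalIntegrable _ _)
  simp only [zero_add, zsmul_eq_mul, mul_one, Int.cast_natCast] at this
  rw [mul_zero, mul_one, this, smul_eq_mul]
  field_simp

lemma generic_est (H h : Lft) (L L' w d κ g δ : ℝ) (q p m : ℕ) (U : ℝ → ℝ) (hL1 : 1 ≤ L)
    (hL : ∀ a b, dist (H.F a) (H.F b) ≤ L * dist a b) (hq : 0 < q) (hpq : Nat.Coprime p q)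
    (hLq : L / q ≤ δ) (hδ : 0 < δ)
    (hcom : ∀ P : ℝ × ℝ, ∀ r : ℤ, h.F (P + ((r / q : ℝ), 0)) = h.F P + ((r / q : ℝ), 0))
    (hU : Continuous U) (hUp : Function.Periodic U 1)
    (hUd : ∀ x : ℝ, |(h.F (x, 1 / 2)).2 - (1 / 2 + U ((q:ℝ) * x))| ≤ d)
    (hU0 : ∀ x : ℝ, 2 * w ≤ x → x ≤ 1 / 2 - w → U x = 0)
    (hU1 : ∀ x : ℝ, 1 / 2 ≤ x → x ≤ 1 - 2 * w → U x = κ * (x - 1))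
    (hdL : d * L ≤ δ)
    (hL' : ∀ a b, dist (H.F (h.F a)) (H.F (h.F b)) ≤ L' * dist a b) (hL'0 : 0 ≤ L') (hm : 0 < m)
    (hL'm : L' / (q * m) ≤ δ) (hUm : ∀ s t, |s - t| ≤ 1 / (m:ℝ) → L * |U s - U t| ≤ δ)
    (hw : 0 < w) (hw' : w < 1 / 16) (hg : 0 < g) (hg1 : g ≤ 1) (hwg : 80 * w ≤ g * δ)
    (hκ : 32 ≤ κ * (g * δ))
    (f : ℝ × ℝ → ℝ) (hf : Continuous f) (hfp : Per f) (C ω : ℝ) (hC : ∀ x, |f x| ≤ C)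
    (hω : ∀ a b, dist a b ≤ δ → |f a - f b| ≤ ω) :
    (∀ z : ℝ, 2 * w ≤ Int.fract ((q:ℝ) * z) → Int.fract ((q:ℝ) * z) ≤ 1 / 2 - w - g → ∀ N : ℕ, (q : ℝ) ≤ N * δ →
      |(N:ℝ)⁻¹ * (∑ j ∈ Finset.range N, f (H.F (h.F (z + j * (p / q + 1 / (q ^ 2 * m)), 1 / 2)))) - I2 f| ≤
        |(∫ t in (0:ℝ)..1, f (H.F (t, 1/2))) - I2 f| + 4 * ω + 3 * C * δ) ∧
    |(∫ t in (0:ℝ)..1, f (H.F (h.F (t, 1/2)))) - I2 f| ≤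
      |(∫ t in (0:ℝ)..1, f (H.F (t, 1/2))) - I2 f| / 2 + 2 * ω + C * δ := by
  have hq0 : (q : ℝ) ≠ 0 := by positivity
  have hqp : (0 : ℝ) < q := by positivity
  have hmp : (0 : ℝ) < m := by positivity
  have hHc := H.hF.continuous
  have hhc := h.hF.continuous
  have hC0 : 0 ≤ C := (abs_nonneg _).trans (hC 0)
  have hω0 : 0 ≤ ω := (abs_nonneg _).trans (hω 0 0 (by simpa using hδ.le))
  set Fb : ℝ → ℝ := fun y => ∫ x in (0:ℝ)..1, f (H.F (x, y)) with hFb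
  have hFbc : Continuous Fb := by
    apply intervalIntegral.continuous_parametric_intervalIntegral_of_continuous'
    simp only [Function.uncurry_def]
    fun_prop
  have hfH : Per (fun p => f (H.F p)) := hfp.comp H.eF
  have hFbp : Function.Periodic Fb 1 := by
    intro y
    simp only [hFb]
    congr 1; ext x
    exact hfH.snd x y
  have hFbC : ∀ y, |Fb y| ≤ C := fun y => abs_integral01_le _ C (fun x => hC _)
  have hFbω : ∀ y y', L * |y - y'| ≤ δ → |Fb y - Fb y'| ≤ ω := by
    intro y y' hy
    apply abs_integral01_sub_le _ _ (by fun_prop) (by fun_prop)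
    intro x
    apply hω
    refine (hL _ _).trans ?_
    rw [dist_pair, sub_self, abs_zero, max_eq_right (abs_nonneg _)]; exact hy
  have hFbI : ∫ y in (0:ℝ)..1, Fb y = I2 f := by
    rw [← H.mp f hf hfp, I2_swap _ (by fun_prop)]
  set I := I2 f with hI
  have hIC : |I| ≤ C := by rw [← hFbI]; exact abs_integral01_le _ C hFbC
  set V : ℝ → ℝ := fun θ => Fb (1 / 2 + U θ) with hV
  have hVc : Continuous V := hFbc.comp (continuous_const.add hU)
  have hVp : Function.Periodic V 1 := fun x => by simp only [hV, hUp x]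
  set φ : ℝ → ℝ := fun x => f (H.F (h.F (x, 1 / 2))) with hφ
  have hφc : Continuous φ := by fun_prop
  have hφp : Function.Periodic φ 1 := (hfH.comp h.eF).fst (1/2)
  have hΨ : ∀ x, |(1 / (q:ℝ)) * (∑ r ∈ Finset.range q, φ (x + r * (p / q))) - V (q * x)| ≤ 2 * ω := by
    intro x
    have e1 : ∀ r : ℕ, φ (x + r * (p / q)) = f (H.F ((h.F (x, 1/2)).1 + r * (p / q), (h.F (x, 1/2)).2)) := by
      intro r
      have := hcom (x, 1/2) (r * p)
      simp only [hφ]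
      have e2 : ((x, 1/2) : ℝ × ℝ) + ((((r * p : ℤ) : ℝ) / q : ℝ), 0) = (x + r * (p / q), 1/2) := by
        ext
        · simp; ring
        · simp
      rw [e2] at this
      rw [this]
      congr 2
      ext
      · simp; ring
      · simp
    simp only [e1]
    have := riemann_coprime (fun t => f (H.F (t, (h.F (x, 1/2)).2))) (by fun_prop) (hfH.fst _) q p hq hpq ω
      (by
        intro s t hst
        apply hω
        refine (hL _ _).trans ?_
        rw [dist_pair, sub_self, abs_zero, max_eq_left (abs_nonneg _)]
        refine le_trans ?_ hLq
        rw [div_eq_mul_one_div]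
        exact mul_le_mul_of_nonneg_left hst (by linarith)) (h.F (x, 1/2)).1
    have h2 : |Fb (h.F (x, 1/2)).2 - V (q * x)| ≤ ω := by
      apply hFbω
      refine le_trans ?_ hdL
      rw [mul_comm]
      exact mul_le_mul_of_nonneg_right (hUd x) (by linarith)
    have h3 : (∫ t in (0:ℝ)..1, (fun t => f (H.F (t, (h.F (x, 1/2)).2))) t) = Fb (h.F (x, 1/2)).2 := rfl
    rw [h3] at this
    rw [abs_le] at *
    constructor <;> linarith [this.1, this.2, h2.1, h2.2]
  set e := |(∫ t in (0:ℝ)..1, f (H.F (t, 1/2))) - I| with he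
  have hos := osc_main (fun θ => V θ - I) (fun y => Fb (1 / 2 + y) - I) (by fun_prop)
    (fun x => by simp only [hVp x]) (by fun_prop)
    (fun x => by
      have : (1:ℝ) / 2 + (x + 1) = 1 / 2 + x + 1 := by ring
      simp only [this, hFbp _])
    C e w κ g δ hC0 (abs_nonneg _) hw hw' hg hg1 hδ hwg hκ
    (fun x => by
      have := hFbC (1 / 2 + U x)
      simp only [hV]
      refine (abs_sub _ _).trans ?_
      linarith)
    (fun x => by
      have := hFbC (1 / 2 + x)
      refine (abs_sub _ _).trans ?_
      linarith)
    (by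
      rw [intervalIntegral.integral_sub (Continuous.intervalIntegrable (by fun_prop) _ _) (by simp)]
      have := per_shift Fb hFbp (1/2)
      simp only [add_comm _ (1/2:ℝ)] at this
      rw [this, hFbI]
      simp)
    (fun x h1 h2 => by
      simp only [hV, hU0 x h1 h2, add_zero]
      exact le_rfl)
    (fun x h1 h2 => by
      simp only [hV, hU1 x h1 h2])
  obtain ⟨hos1, hos2⟩ := hos
  constructor
  · intro z hz1 hz2 N hN
    set α : ℝ := p / q + 1 / (q ^ 2 * m) with hα
    have hblock : ∀ i : ℕ, |∑ r ∈ Finset.range q, φ (z + ((i * q + r : ℕ) : ℝ) * α) - q * V (q * z + i * (1 / m))| ≤ 3 * q * ω := by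
      intro i
      have h1 : ∀ r ∈ Finset.range q, |φ (z + ((i * q + r : ℕ) : ℝ) * α) - φ (z + i * (1 / (q * m)) + r * (p / q))| ≤ ω := by
        intro r hr
        have hr' : (r : ℝ) ≤ q := by
          have := Finset.mem_range.1 hr
          exact_mod_cast this.le
        have e1 : z + ((i * q + r : ℕ) : ℝ) * α = (z + i * (1 / (q * m)) + r * (p / q) + r * (1 / (q^2 * m))) + ((i * p : ℕ) : ℝ) * 1 := by
          rw [hα]; push_cast; field_simp; ring
        rw [e1, hφp.nat_mul]
        apply hω
        refine (hL' _ _).trans ?_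
        rw [dist_pair, sub_self, abs_zero, max_eq_left (abs_nonneg _)]
        refine le_trans ?_ hL'm
        rw [div_eq_mul_one_div L']
        apply mul_le_mul_of_nonneg_left _ hL'0
        rw [add_sub_cancel_left, abs_of_nonneg (by positivity)]
        calc (r:ℝ) * (1 / ((q:ℝ)^2 * m)) ≤ (q:ℝ) * (1 / ((q:ℝ)^2 * m)) := by gcongr
          _ = 1 / ((q:ℝ) * m) := by field_simp
      have h2 : |∑ r ∈ Finset.range q, φ (z + ((i * q + r : ℕ) : ℝ) * α) - ∑ r ∈ Finset.range q, φ (z + i * (1 / (q * m)) + r * (p / q))| ≤ q * ω := by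
        rw [← Finset.sum_sub_distrib]
        refine (Finset.abs_sum_le_sum_abs _ _).trans ?_
        refine (Finset.sum_le_sum h1).trans ?_
        simp
      have h3 := hΨ (z + i * (1 / (q * m)))
      have e2 : (q:ℝ) * (z + i * (1 / (q * m))) = q * z + i * (1 / m) := by field_simp
      rw [e2] at h3
      set A := ∑ r ∈ Finset.range q, φ (z + i * (1 / (q * m)) + r * (p / q))
      have h4 : |A - q * V (q * z + i * (1 / m))| ≤ q * (2 * ω) := by
        have e3 : A - q * V (q * z + i * (1 / m)) = q * ((1 / (q:ℝ)) * A - V (q * z + i * (1 / m))) := by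
          field_simp
        rw [e3, abs_mul, abs_of_pos hqp]
        exact mul_le_mul_of_nonneg_left h3 hqp.le
      rw [abs_le] at *
      constructor <;> linarith [h2.1, h2.2, h4.1, h4.2]
    have hblocks : ∀ M : ℕ, |∑ j ∈ Finset.range (M * q), φ (z + (j:ℝ) * α) - q * ∑ i ∈ Finset.range M, V (q * z + i * (1 / m))| ≤ M * (3 * q * ω) := by
      intro M
      induction M with
      | zero => simp
      | succ M ih =>
        rw [add_mul, one_mul, Finset.sum_range_add, Finset.sum_range_succ]
        have := hblock M
        push_cast at *
        rw [abs_le] at *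
        constructor <;> linarith [this.1, this.2, ih.1, ih.2]
    set M := N / q with hM
    have hr1 := riemann_sum V hVc (1 / m) ω (by positivity) (fun s t hst => by
      apply hFbω
      rw [add_sub_add_left_eq_sub]
      exact hUm s t hst) (q * z) M
    set T : ℝ := M * (1 / m) with hT
    have hT0 : 0 ≤ T := by positivity
    have hIntV : |(∫ t in (q * z)..(q * z + T), V t) - T * I| ≤ (e + C * δ) * T := by
      have h1 := hos1 (Int.fract ((q:ℝ) * z)) T hz1 hz2 hT0
      rw [intervalIntegral.integral_sub (hVc.intervalIntegrable _ _) (by simp),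
        intervalIntegral.integral_const, add_sub_cancel_left, smul_eq_mul] at h1
      have h2 : ∫ t in (q * z)..(q * z + T), V t = ∫ t in (Int.fract ((q:ℝ) * z))..(Int.fract ((q:ℝ) * z) + T), V t := by
        have e1 : q * z = Int.fract ((q:ℝ) * z) + ⌊(q:ℝ) * z⌋ := (Int.fract_add_floor _).symm
        have h3 := intervalIntegral.integral_comp_add_right (a := Int.fract ((q:ℝ) * z))
          (b := Int.fract ((q:ℝ) * z) + T) V (⌊(q:ℝ) * z⌋ : ℝ)
        have e2 : Int.fract ((q:ℝ) * z) + T + ⌊(q:ℝ) * z⌋ = q * z + T := by linarith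
        rw [← e1, e2] at h3
        rw [← h3]
        congr 1; ext x
        have := hVp.int_mul ⌊(q:ℝ) * z⌋ x
        rw [mul_one] at this; exact this
      rw [h2]; exact h1
    have hN0 : (0:ℝ) < N := by
      by_contra hcon
      have : (N:ℝ) = 0 := le_antisymm (not_lt.1 hcon) (by positivity)
      rw [this, zero_mul] at hN; linarith
    have hMq : (M:ℝ) * q ≤ N := by exact_mod_cast Nat.div_mul_le_self N q
    have hsum : |∑ j ∈ Finset.range (M * q), φ (z + (j:ℝ) * α) - M * q * I| ≤ M * q * (e + 4 * ω + C * δ) := by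
      have h1 := hblocks M
      set S := ∑ i ∈ Finset.range M, V (q * z + i * (1 / m))
      have h2 : |q * S - M * q * I| ≤ M * q * (e + ω + C * δ) := by
        have e1 : q * S - M * q * I = (q * m) * (((1:ℝ) / m * S - ∫ t in (q * z)..(q * z + T), V t) +
            ((∫ t in (q * z)..(q * z + T), V t) - T * I)) := by
          rw [hT]; field_simp; ring
        rw [e1, abs_mul, abs_of_pos (by positivity : (0:ℝ) < q * m)]
        have e2 : (M:ℝ) * q * (e + ω + C * δ) = (q * m) * (T * ω + (e + C * δ) * T) := by
          rw [hT]; field_simp; ring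
        rw [e2]
        apply mul_le_mul_of_nonneg_left _ (by positivity)
        exact (abs_add_le _ _).trans (add_le_add hr1 hIntV)
      rw [abs_le] at *
      constructor <;> linarith [h1.1, h1.2, h2.1, h2.2]
    have htail : |∑ j ∈ Finset.range N, φ (z + (j:ℝ) * α) - N * I - (∑ j ∈ Finset.range (M * q), φ (z + (j:ℝ) * α) - M * q * I)| ≤ 2 * C * q := by
      obtain ⟨k, hk⟩ : ∃ k, k = N % q := ⟨_, rfl⟩
      have hkq : k < q := hk ▸ Nat.mod_lt _ hq
      have hNk : N = M * q + k := by rw [hk, hM, Nat.div_add_mod']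
      have hNk' : (N:ℝ) = M * q + k := by exact_mod_cast hNk
      rw [hNk', hNk, Finset.sum_range_add]
      set B := ∑ j ∈ Finset.range k, φ (z + ((M * q + j : ℕ):ℝ) * α)
      have hB : |B| ≤ k * C := by
        refine (Finset.abs_sum_le_sum_abs _ _).trans ?_
        refine (Finset.sum_le_sum (fun i _ => hC _)).trans ?_
        simp
      have hkI : |(k:ℝ) * I| ≤ k * C := by
        rw [abs_mul, Nat.abs_cast]; exact mul_le_mul_of_nonneg_left hIC (by positivity)
      have hkq' : (k:ℝ) ≤ q := by exact_mod_cast hkq.le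
      have : (k:ℝ) * C ≤ q * C := mul_le_mul_of_nonneg_right hkq' hC0
      rw [abs_le] at *
      constructor <;> linarith [hB.1, hB.2, hkI.1, hkI.2]
    have hE : 0 ≤ e + 4 * ω + C * δ := by positivity
    have hfin : |∑ j ∈ Finset.range N, φ (z + (j:ℝ) * α) - N * I| ≤ N * (e + 4 * ω + 3 * C * δ) := by
      have h1 : (M:ℝ) * q * (e + 4 * ω + C * δ) ≤ N * (e + 4 * ω + C * δ) := mul_le_mul_of_nonneg_right hMq hE
      have h2 : C * q ≤ C * (N * δ) := mul_le_mul_of_nonneg_left hN hC0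
      rw [abs_le] at *
      constructor <;> linarith [hsum.1, hsum.2, htail.1, htail.2]
    have e3 : (N:ℝ)⁻¹ * (∑ j ∈ Finset.range N, φ (z + (j:ℝ) * α)) - I =
        (N:ℝ)⁻¹ * (∑ j ∈ Finset.range N, φ (z + (j:ℝ) * α) - N * I) := by
      rw [mul_sub, ← mul_assoc _ (N:ℝ) I, inv_mul_cancel₀ hN0.ne', one_mul]
    change |(N:ℝ)⁻¹ * (∑ j ∈ Finset.range N, φ (z + (j:ℝ) * α)) - I| ≤ _
    rw [e3, abs_mul, abs_of_pos (inv_pos.2 hN0), inv_mul_le_iff₀ hN0]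
    exact hfin
  · have h1 : ∫ x in (0:ℝ)..1, (1 / (q:ℝ)) * (∑ r ∈ Finset.range q, φ (x + r * (p / q))) = ∫ x in (0:ℝ)..1, φ x := by
      rw [intervalIntegral.integral_const_mul, intervalIntegral.integral_finset_sum
        (fun i _ => Continuous.intervalIntegrable (by fun_prop) _ _)]
      simp only [per_shift φ hφp]
      simp
      field_simp
    have h2 := abs_integral01_sub_le _ _ (by fun_prop) (hVc.comp (by fun_prop)) _ hΨ
    rw [h1] at h2
    have h3 : ∫ x in (0:ℝ)..1, (V ∘ fun x => (q:ℝ) * x) x = ∫ x in (0:ℝ)..1, V x := integral_per_scale V hVc hVp q hq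
    rw [h3] at h2
    rw [intervalIntegral.integral_sub (hVc.intervalIntegrable _ _) (by simp)] at hos2
    simp only [intervalIntegral.integral_const, sub_zero, one_smul] at hos2
    change |(∫ x in (0:ℝ)..1, φ x) - I| ≤ _
    rw [abs_le] at *
    constructor <;> linarith [h2.1, h2.2, hos2.1, hos2.2]


lemma vol_fract (q : ℕ) (hq : 0 < q) (a b : ℝ) (ha : 0 ≤ a) (hb : b ≤ 1) :
    volume {x : ℝ | 0 ≤ x ∧ x < 1 ∧ ¬ (a ≤ Int.fract ((q:ℝ) * x) ∧ Int.fract ((q:ℝ) * x) ≤ b)} ≤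
      ENNReal.ofReal (a + (1 - b)) := by
  have hqp : (0 : ℝ) < q := by positivity
  have hsub : {x : ℝ | 0 ≤ x ∧ x < 1 ∧ ¬ (a ≤ Int.fract ((q:ℝ) * x) ∧ Int.fract ((q:ℝ) * x) ≤ b)} ⊆
      ⋃ i ∈ Finset.range q, (Set.Icc ((i:ℝ) / q) ((i + a) / q) ∪ Set.Icc (((i:ℝ) + b) / q) ((i + 1) / q)) := by
    rintro x ⟨h0, h1, h2⟩
    have hn : 0 ≤ (q:ℝ) * x := by positivity
    have hfl : ((⌊(q:ℝ) * x⌋₊ : ℕ) : ℝ) + Int.fract ((q:ℝ) * x) = q * x := by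
      have := Int.floor_add_fract ((q:ℝ) * x)
      rw [natCast_floor_eq_intCast_floor hn]; exact this
    have hlt : ⌊(q:ℝ) * x⌋₊ < q := by
      rw [Nat.floor_lt hn]; nlinarith
    rw [Set.mem_iUnion₂]
    refine ⟨⌊(q:ℝ) * x⌋₊, Finset.mem_range.2 hlt, ?_⟩
    have f0 := Int.fract_nonneg ((q:ℝ) * x)
    have f1 := Int.fract_lt_one ((q:ℝ) * x)
    rw [not_and_or, not_le, not_le] at h2
    rcases h2 with h2 | h2
    · left
      constructor
      · rw [div_le_iff₀ hqp]; linarith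
      · rw [le_div_iff₀ hqp]; linarith
    · right
      constructor
      · rw [div_le_iff₀ hqp]; linarith
      · rw [le_div_iff₀ hqp]; linarith
  refine (measure_mono hsub).trans ?_
  refine (measure_biUnion_finset_le _ _).trans ?_
  have : ∀ i ∈ Finset.range q, volume (Set.Icc ((i:ℝ) / q) ((i + a) / q) ∪ Set.Icc (((i:ℝ) + b) / q) ((i + 1) / q)) ≤
      ENNReal.ofReal ((a + (1 - b)) / q) := by
    intro i _
    refine (measure_union_le _ _).trans ?_
    rw [Real.volume_Icc, Real.volume_Icc, ← ENNReal.ofReal_add]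
    · apply ENNReal.ofReal_le_ofReal
      apply le_of_eq; field_simp; ring
    · rw [← sub_div]; apply div_nonneg _ hqp.le; linarith
    · rw [← sub_div]; apply div_nonneg _ hqp.le; linarith
  refine (Finset.sum_le_sum this).trans ?_
  rw [Finset.sum_const, Finset.card_range, nsmul_eq_mul, ← ENNReal.ofReal_natCast, ← ENNReal.ofReal_mul (by positivity)]
  apply ENNReal.ofReal_le_ofReal
  apply le_of_eq; field_simp

lemma integral_except (D : ℝ → ℝ) (hD : Continuous D) (q : ℕ) (hq : 0 < q) (a b c : ℝ) (ha : 0 ≤ a) (hb : b ≤ 1)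
    (hc : 0 ≤ c) (h2 : ∀ x, |D x| ≤ 2)
    (hgood : ∀ x, a ≤ Int.fract ((q:ℝ) * x) → Int.fract ((q:ℝ) * x) ≤ b → |D x| ≤ c) :
    |∫ x in (0:ℝ)..1, D x| ≤ c + 2 * (a + (1 - b)) := by
  set B : Set ℝ := {x : ℝ | 0 ≤ x ∧ x < 1 ∧ ¬ (a ≤ Int.fract ((q:ℝ) * x) ∧ Int.fract ((q:ℝ) * x) ≤ b)} with hB
  have hBm : MeasurableSet B := by
    have hm : Measurable (fun x : ℝ => Int.fract ((q:ℝ) * x)) := measurable_fract.comp (by fun_prop)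
    have e : B = Set.Ico 0 1 ∩ (fun x : ℝ => Int.fract ((q:ℝ) * x)) ⁻¹' (Set.Icc a b)ᶜ := by
      ext x; simp only [hB, Set.mem_inter_iff, Set.mem_setOf_eq, Set.mem_Ico, Set.mem_preimage, Set.mem_compl_iff, Set.mem_Icc]
      tauto
    rw [e]
    exact measurableSet_Ico.inter (hm measurableSet_Icc.compl)
  have hvol := vol_fract q hq a b ha hb
  have hbi : IntegrableOn (B.indicator (fun _ => (2:ℝ))) (Set.Ioo 0 1) volume := by
    apply Integrable.indicator _ hBm
    simp
  have hb' : IntegrableOn (fun x => c + B.indicator (fun _ => (2:ℝ)) x) (Set.Ioo 0 1) volume :=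
    Integrable.add (by simp) hbi
  rw [intervalIntegral.integral_of_le zero_le_one, integral_Ioc_eq_integral_Ioo]
  have h1 : |∫ x in Set.Ioo (0:ℝ) 1, D x| ≤ ∫ x in Set.Ioo (0:ℝ) 1, (c + B.indicator (fun _ => (2:ℝ)) x) := by
    rw [← Real.norm_eq_abs]
    apply norm_integral_le_of_norm_le hb'
    rw [ae_restrict_iff' measurableSet_Ioo]
    refine Eventually.of_forall (fun x hx => ?_)
    rw [Real.norm_eq_abs]
    by_cases hxB : x ∈ B
    · rw [Set.indicator_of_mem hxB]; linarith [h2 x]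
    · rw [Set.indicator_of_notMem hxB, add_zero]
      have : a ≤ Int.fract ((q:ℝ) * x) ∧ Int.fract ((q:ℝ) * x) ≤ b := by
        by_contra hcon
        exact hxB ⟨hx.1.le, hx.2, hcon⟩
      exact hgood x this.1 this.2
  refine h1.trans ?_
  have hab : 0 ≤ a + (1 - b) := by linarith
  rw [integral_add (by simp) hbi, integral_indicator hBm]
  simp only [integral_const, smul_eq_mul, measureReal_restrict_apply MeasurableSet.univ, Set.univ_inter]
  have h3 : (volume.restrict (Set.Ioo (0:ℝ) 1)).real B ≤ a + (1 - b) := by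
    rw [measureReal_def]
    apply ENNReal.toReal_le_of_le_ofReal hab
    exact (Measure.restrict_apply_le _ _).trans hvol
  have h4 : volume.real (Set.Ioo (0:ℝ) 1) = 1 := by simp
  simp only [measureReal_restrict_apply MeasurableSet.univ, Set.univ_inter, h4]
  linarith

lemma nongeneric_est (H h : Lft) (L w d ℓ : ℝ) (q : ℕ) (hL1 : 1 ≤ L)
    (hL : ∀ a b, dist (H.F a) (H.F b) ≤ L * dist a b) (hq : 0 < q) (hw : 0 < w) (hd : 0 < d)
    (hℓ : 0 ≤ ℓ)
    (hh : ∀ P : ℝ × ℝ, 4 * w ≤ Int.fract ((q:ℝ) * P.1) → Int.fract ((q:ℝ) * P.1) ≤ 1 - 2 * w →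
      (∀ k : ℤ, 8 * d ≤ |P.2 - 1 / 2 - k|) → ∀ x : ℝ, 4 * w ≤ Int.fract ((q:ℝ) * x) → Int.fract ((q:ℝ) * x) ≤ 1 - 2 * w →
        (h.F (x, (h.G P).2)).1 = x ∧ |(h.F (x, (h.G P).2)).2 - P.2| ≤ 4 * d)
    (P : ℝ × ℝ) (h1 : 4 * w ≤ Int.fract ((q:ℝ) * P.1)) (h2 : Int.fract ((q:ℝ) * P.1) ≤ 1 - 2 * w)
    (h3 : ∀ k : ℤ, 8 * d ≤ |P.2 - 1 / 2 - k|) (g : ℝ × ℝ → ℝ) (hg : Continuous g) (hg1 : ∀ x, |g x| ≤ 1)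
    (hgl : ∀ a b, |g a - g b| ≤ ℓ * dist a b) :
    |(∫ x in (0:ℝ)..1, g (H.F (h.F (x, (h.G P).2)))) - ∫ x in (0:ℝ)..1, g (H.F (x, P.2))| ≤
      12 * w + 4 * ℓ * L * d := by
  have hHc := H.hF.continuous
  have hhc := h.hF.continuous
  rw [← intervalIntegral.integral_sub (Continuous.intervalIntegrable (by fun_prop) _ _)
    (Continuous.intervalIntegrable (by fun_prop) _ _)]
  have := integral_except (fun x => g (H.F (h.F (x, (h.G P).2))) - g (H.F (x, P.2))) (by fun_prop) q hq
    (4 * w) (1 - 2 * w) (4 * ℓ * L * d) (by linarith) (by linarith) (by positivity)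
    (fun x => (abs_sub _ _).trans (by linarith [hg1 (H.F (h.F (x, (h.G P).2))), hg1 (H.F (x, P.2))]))
    (fun x h4 h5 => by
      obtain ⟨e1, e2⟩ := hh P h1 h2 h3 x h4 h5
      refine (hgl _ _).trans ?_
      have : dist (h.F (x, (h.G P).2)) (x, P.2) ≤ 4 * d := by
        rw [Prod.dist_eq, Real.dist_eq, Real.dist_eq, e1, sub_self, abs_zero, max_eq_right (abs_nonneg _)]
        exact e2
      calc _ ≤ ℓ * (L * dist (h.F (x, (h.G P).2)) (x, P.2)) := mul_le_mul_of_nonneg_left (hL _ _) hℓ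
        _ ≤ ℓ * (L * (4 * d)) := by gcongr
        _ = _ := by ring)
  refine this.trans ?_
  linarith

lemma torusProj_dist_le (a b : ℝ × ℝ) : dist (torusProj a) (torusProj b) ≤ dist a b := by
  rw [Prod.dist_eq, Prod.dist_eq]
  have key : ∀ x y : ℝ, dist (x : UnitAddCircle) (y : UnitAddCircle) ≤ dist x y := by
    intro x y
    rw [dist_eq_norm, dist_eq_norm, ← AddCircle.coe_sub]
    exact QuotientAddGroup.norm_mk_le_norm
  exact max_le_max (key _ _) (key _ _)

lemma torusProj_add (p : ℝ × ℝ) (m : ℤ × ℤ) : torusProj (p + ((m.1 : ℝ), (m.2 : ℝ))) = torusProj p := by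
  unfold torusProj
  ext
  · simp
  · simp

/-- small covers -/
def Cov (n : ℕ) (Z : Set Torus2) : Prop :=
  ∃ (N : ℕ) (ρ : ℝ) (c : Fin N → Set Torus2), 0 < ρ ∧ ρ ≤ (1/2) ^ n ∧ N * ρ ^ 3 ≤ (1/2) ^ n ∧
    Z ⊆ (⋃ i, c i) ∧ ∀ i, ∀ x ∈ c i, ∀ y ∈ c i, dist x y ≤ ρ ^ 2

lemma exists_cov (n : ℕ) (H : Lft) (L : ℝ) (q : ℕ) (hL1 : 1 ≤ L)
    (hL : ∀ a b, dist (H.F a) (H.F b) ≤ L * dist a b) (hq : 0 < q) :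
    ∃ η > 0, ∀ w d : ℝ, 0 < w → w ≤ η → 0 < d → d ≤ η → ∃ Z, Cov n Z ∧ ∀ P : ℝ × ℝ, torusProj (H.F P) ∉ Z →
      4 * w ≤ Int.fract ((q:ℝ) * P.1) ∧ Int.fract ((q:ℝ) * P.1) ≤ 1 - 2 * w ∧
      ∀ k : ℤ, 8 * d ≤ |P.2 - 1 / 2 - k| := by
  have hqp : (0 : ℝ) < q := by positivity
  obtain ⟨k, hk⟩ : ∃ k : ℕ, (q + 2) * L ^ 3 * 2 ^ n ≤ k := exists_nat_ge _
  have hk0 : (0:ℝ) < k := lt_of_lt_of_le (by positivity) hk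
  have hk1 : (1:ℝ) ≤ k := by
    have : 0 < k := by exact_mod_cast hk0
    exact_mod_cast this
  set D : ℕ := k ^ 2 with hD
  have hDp : (0:ℝ) < D := by rw [hD]; push_cast; positivity
  have hDk : (D:ℝ) = k ^ 2 := by rw [hD]; push_cast; rfl
  refine ⟨min (1 / (16 * D)) (1/64), lt_min (by positivity) (by norm_num), ?_⟩
  intro w d hw hwη hd hdη
  have hw1 : w * (16 * D) ≤ 1 := by
    have := hwη.trans (min_le_left _ _)
    rwa [le_div_iff₀ (by positivity)] at this
  have hd1 : d * (16 * D) ≤ 1 := by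
    have := hdη.trans (min_le_left _ _)
    rwa [le_div_iff₀ (by positivity)] at this
  have hd2 : d ≤ 1/64 := hdη.trans (min_le_right _ _)
  have hw2 : w ≤ 1/64 := hwη.trans (min_le_right _ _)
  set box : Fin (q + 2) × Fin D → Set (ℝ × ℝ) := fun ij =>
    if (ij.1 : ℕ) ≤ q then
      Set.Icc (((ij.1 : ℕ) : ℝ) / q - 2 * w / q) (((ij.1 : ℕ) : ℝ) / q + 4 * w / q) ×ˢ
        Set.Icc (((ij.2 : ℕ) : ℝ) / D) ((((ij.2 : ℕ) : ℝ) + 1) / D)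
    else Set.Icc (((ij.2 : ℕ) : ℝ) / D) ((((ij.2 : ℕ) : ℝ) + 1) / D) ×ˢ Set.Icc (1/2 - 8 * d) (1/2 + 8 * d) with hbox
  have hbd : ∀ ij, ∀ a ∈ box ij, ∀ b ∈ box ij, dist a b ≤ 1 / D := by
    rintro ⟨i, j⟩ ⟨a1, a2⟩ ha ⟨b1, b2⟩ hb
    have hi : ∀ u v s t : ℝ, t - s ≤ 1 / D → u ∈ Set.Icc s t → v ∈ Set.Icc s t → |u - v| ≤ 1 / D := by
      intro u v s t hst hu hv
      rw [abs_le]; constructor <;> linarith [hu.1, hu.2, hv.1, hv.2]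
    have s1 : (((j : ℕ) : ℝ) + 1) / D - ((j : ℕ) : ℝ) / D ≤ 1 / D := by
      apply le_of_eq; ring
    have s2 : (((i : ℕ) : ℝ) / q + 4 * w / q) - (((i : ℕ) : ℝ) / q - 2 * w / q) ≤ 1 / D := by
      have e : (((i : ℕ) : ℝ) / q + 4 * w / q) - (((i : ℕ) : ℝ) / q - 2 * w / q) = 6 * w / q := by ring
      rw [e, div_le_div_iff₀ hqp hDp]
      have : (1:ℝ) ≤ q := by exact_mod_cast hq
      nlinarith
    have s3 : (1/2 + 8 * d) - (1/2 - 8 * d) ≤ 1 / D := by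
      rw [le_div_iff₀ hDp]; linarith
    rw [dist_pair]
    by_cases h : (i : ℕ) ≤ q
    · simp only [hbox, h, if_true] at ha hb
      exact max_le (hi _ _ _ _ s2 ha.1 hb.1) (hi _ _ _ _ s1 ha.2 hb.2)
    · simp only [hbox, h, if_false] at ha hb
      exact max_le (hi _ _ _ _ s1 ha.1 hb.1) (hi _ _ _ _ s3 ha.2 hb.2)
  set E := (finProdFinEquiv : Fin (q + 2) × Fin D ≃ Fin ((q + 2) * D))
  refine ⟨⋃ ij, (fun x => torusProj (H.F x)) '' box ij, ⟨(q + 2) * D, L / k,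
    fun i => (fun x => torusProj (H.F x)) '' box (E.symm i), by positivity, ?_, ?_, ?_, ?_⟩, ?_⟩
  · rw [one_div, inv_pow, div_le_iff₀ hk0, inv_mul_eq_div, le_div_iff₀ (by positivity)]
    refine le_trans ?_ hk
    have h1 : L ≤ (q + 2) * L ^ 3 := by
      have : L ≤ L ^ 3 := le_self_pow₀ hL1 (by norm_num)
      nlinarith
    exact mul_le_mul_of_nonneg_right h1 (by positivity)
  · push_cast
    rw [hDk]
    have e : ((q:ℝ) + 2) * (k:ℝ) ^ 2 * (L / k) ^ 3 = (q + 2) * L ^ 3 / k := by field_simp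
    rw [e, one_div, inv_pow, div_le_iff₀ hk0, inv_mul_eq_div, le_div_iff₀ (by positivity)]
    exact hk
  · apply Set.iUnion_subset
    intro ij
    refine Set.subset_iUnion_of_subset (E ij) ?_
    rw [Equiv.symm_apply_apply]
  · rintro i _ ⟨a, ha, rfl⟩ _ ⟨b, hb, rfl⟩
    refine (torusProj_dist_le _ _).trans ((hL _ _).trans ?_)
    have := hbd _ a ha b hb
    calc L * dist a b ≤ L * (1 / D) := by gcongr
      _ ≤ (L / k) ^ 2 := by
        rw [hDk, div_pow, mul_one_div]
        gcongr
        nlinarith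
  · intro P hP
    obtain ⟨P0, m, hP0, rfl⟩ : ∃ p0 : ℝ × ℝ, ∃ m : ℤ × ℤ, (0 ≤ p0.1 ∧ p0.1 < 1 ∧ 0 ≤ p0.2 ∧ p0.2 < 1) ∧
        P = p0 + ((m.1 : ℝ), (m.2 : ℝ)) := by
      refine ⟨(Int.fract P.1, Int.fract P.2), (⌊P.1⌋, ⌊P.2⌋), ⟨Int.fract_nonneg _, (Int.fract_lt_one _),
        Int.fract_nonneg _, (Int.fract_lt_one _)⟩, ?_⟩
      ext <;> simp
    obtain ⟨x0, x1, y0, y1⟩ := hP0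
    rw [H.eF, torusProj_add] at hP
    have hP' : ∀ ij, P0 ∉ box ij := by
      intro ij hij
      exact hP (Set.mem_iUnion.2 ⟨ij, P0, hij, rfl⟩)
    have e1 : Int.fract ((q:ℝ) * (P0 + ((m.1 : ℝ), (m.2 : ℝ))).1) = Int.fract ((q:ℝ) * P0.1) := by
      have : (q:ℝ) * (P0 + ((m.1 : ℝ), (m.2 : ℝ))).1 = q * P0.1 + ((q * m.1 : ℤ) : ℝ) := by
        push_cast; simp; ring
      rw [this, Int.fract_add_intCast]
    rw [e1]
    have slot : ∀ t : ℝ, 0 ≤ t → t < 1 → ∃ j : Fin D, t ∈ Set.Icc (((j : ℕ) : ℝ) / D) ((((j : ℕ) : ℝ) + 1) / D) := by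
      intro t h0 h1
      have hn : 0 ≤ (D:ℝ) * t := by positivity
      have hlt : ⌊(D:ℝ) * t⌋₊ < D := by
        rw [Nat.floor_lt hn]; nlinarith
      refine ⟨⟨⌊(D:ℝ) * t⌋₊, hlt⟩, ?_, ?_⟩
      · rw [div_le_iff₀ hDp]; have := Nat.floor_le hn; dsimp only; linarith
      · rw [le_div_iff₀ hDp]; have := Nat.lt_floor_add_one ((D:ℝ) * t); dsimp only; linarith
    have hn : 0 ≤ (q:ℝ) * P0.1 := by positivity
    have hlt : ⌊(q:ℝ) * P0.1⌋₊ < q := by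
      rw [Nat.floor_lt hn]; nlinarith
    have hfl : ((⌊(q:ℝ) * P0.1⌋₊ : ℕ) : ℝ) + Int.fract ((q:ℝ) * P0.1) = q * P0.1 := by
      have := Int.floor_add_fract ((q:ℝ) * P0.1)
      rw [natCast_floor_eq_intCast_floor hn]; exact this
    have f0 := Int.fract_nonneg ((q:ℝ) * P0.1)
    have f1 := Int.fract_lt_one ((q:ℝ) * P0.1)
    obtain ⟨j, hj⟩ := slot P0.2 y0 y1
    refine ⟨?_, ?_, ?_⟩
    · by_contra hcon
      push Not at hcon
      apply hP' (⟨⌊(q:ℝ) * P0.1⌋₊, by omega⟩, j)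
      simp only [hbox]
      rw [if_pos hlt.le]
      refine ⟨⟨?_, ?_⟩, hj⟩
      · rw [← sub_div, div_le_iff₀ hqp]; linarith
      · rw [← add_div, le_div_iff₀ hqp]; linarith
    · by_contra hcon
      push Not at hcon
      apply hP' (⟨⌊(q:ℝ) * P0.1⌋₊ + 1, by omega⟩, j)
      simp only [hbox]
      rw [if_pos (by omega)]
      refine ⟨⟨?_, ?_⟩, hj⟩
      · rw [← sub_div, div_le_iff₀ hqp]; push_cast; linarith
      · rw [← add_div, le_div_iff₀ hqp]; push_cast; linarith
    · intro l
      by_contra hcon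
      push Not at hcon
      rw [abs_lt] at hcon
      simp only [Prod.snd_add] at hcon
      have hl : l - m.2 = 0 := by
        have i1 : ((l - m.2 : ℤ) : ℝ) < 1 := by push_cast; linarith [hcon.1]
        have i2 : (-1 : ℝ) < ((l - m.2 : ℤ) : ℝ) := by push_cast; linarith [hcon.2]
        have i3 : l - m.2 < 1 := by exact_mod_cast i1
        have i4 : -1 < l - m.2 := by exact_mod_cast i2
        omega
      have hl' : (l : ℝ) = m.2 := by
        have : l = m.2 := by omega
        rw [this]
      rw [hl'] at hcon
      obtain ⟨j', hj'⟩ := slot P0.1 x0 x1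
      apply hP' (⟨q + 1, by omega⟩, j')
      simp only [hbox]
      rw [if_neg (by omega)]
      exact ⟨hj', by linarith [hcon.1], by linarith [hcon.2]⟩


lemma per_uc (U : ℝ → ℝ) (hU : Continuous U) (hUp : Function.Periodic U 1) (ε : ℝ) (hε : 0 < ε) :
    ∃ η > 0, ∀ s t, |s - t| < η → |U s - U t| < ε := by
  have hc : Continuous (hUp.lift : AddCircle (1:ℝ) → ℝ) := by
    apply continuous_coinduced_dom.2
    exact hU
  have hu := CompactSpace.uniformContinuous_of_continuous hc
  rw [Metric.uniformContinuous_iff] at hu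
  obtain ⟨η, hη, h⟩ := hu ε hε
  refine ⟨η, hη, fun s t hst => ?_⟩
  have := h (a := (s : AddCircle (1:ℝ))) (b := (t : AddCircle (1:ℝ))) (by
    refine lt_of_le_of_lt ?_ hst
    rw [dist_eq_norm, ← AddCircle.coe_sub, ← Real.norm_eq_abs]
    exact QuotientAddGroup.norm_mk_le_norm)
  simpa [Real.dist_eq] using this

/-- A stage of the construction. -/
structure Stage where
  H : Lft
  p : ℕ
  q : ℕ
  L : ℝ
  ell : ℝ
  hq : 0 < q
  hpq : Nat.Coprime p q
  hL1 : 1 ≤ L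
  lF : ∀ a b, dist (H.F a) (H.F b) ≤ L * dist a b
  lG : ∀ a b, dist (H.G a) (H.G b) ≤ L * dist a b
  hell : 7 * L ≤ ell

def Stage.al (s : Stage) : ℝ := s.p / s.q

def Stage.T (s : Stage) : Lft := cnj s.H s.al

/-- mean error on the special circle -/
def Stage.err (s : Stage) (f : ℝ × ℝ → ℝ) : ℝ := |(∫ t in (0:ℝ)..1, f (s.H.F (t, 1/2))) - I2 f|

structure Step (n : ℕ) (s s' : Stage) : Prop where
  sm : s'.L / s'.q ≤ (1/2) ^ (n + 1)
  ell : s.ell ≤ s'.ell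
  qq : s.q ≤ s'.q
  dF : ∀ k ≤ n, ∀ x, ‖iteratedFDeriv ℝ k (fun P => s'.T.F P - s.T.F P) x‖ ≤ (1/2) ^ n
  dG : ∀ k ≤ n, ∀ x, ‖iteratedFDeriv ℝ k (fun P => s'.T.G P - s.T.G P) x‖ ≤ (1/2) ^ n
  it : ∀ j : ℕ, j ≤ 2 ^ (n + 1) * s.q → ∀ P, dist (s'.T.F^[j] P) (s.T.F^[j] P) ≤ (1/2) ^ n
  bad : ∃ Z, Cov n Z ∧ ∀ P, torusProj P ∉ Z → ∀ g : ℝ × ℝ → ℝ, Continuous g → (∀ x, |g x| ≤ 1) →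
    (∀ a b, |g a - g b| ≤ s.ell * dist a b) →
    |(∫ x in (0:ℝ)..1, g (s'.H.F (x, (s'.H.G P).2))) - ∫ x in (0:ℝ)..1, g (s.H.F (x, (s.H.G P).2))| ≤
      (1/2) ^ (n + 4)
  gen : ∃ (J : Set ℝ) (σ : ℝ → ℝ), volume (Set.Ico 0 1 \ J) ≤ ENNReal.ofReal ((1/4) ^ n / 8) ∧
    (∀ x ∈ Set.Ico (0:ℝ) 1, σ x ∈ Set.Ico (0:ℝ) 1) ∧ (∀ x y, |x - y| ≤ 2 * |σ x - σ y|) ∧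
    (∀ x ∈ J, s'.H.F (σ x, 1/2) = s.H.F (x, 1/2)) ∧
    ∀ x ∈ J, ∀ (f : ℝ × ℝ → ℝ) (C ω : ℝ), Continuous f → Per f → (∀ x, |f x| ≤ C) →
      (∀ a b, dist a b ≤ (1/2) ^ n → |f a - f b| ≤ ω) → ∀ N : ℕ, (s.q : ℝ) ≤ N * (1/2) ^ n →
      |(N:ℝ)⁻¹ * (∑ j ∈ Finset.range N, f (s'.H.F (σ x + j * s'.al, 1 / 2))) - I2 f| ≤
        s.err f + 4 * ω + 3 * C * (1/2) ^ n
  av : ∀ (f : ℝ × ℝ → ℝ) (C ω : ℝ), Continuous f → Per f → (∀ x, |f x| ≤ C) →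
      (∀ a b, dist a b ≤ (1/2) ^ n → |f a - f b| ≤ ω) →
      s'.err f ≤ s.err f / 2 + 2 * ω + C * (1/2) ^ n

lemma sigma_anti (q : ℕ) (hq : 0 < q) (x y : ℝ) :
    |x - y| ≤ 2 * |(x + ⌊(q:ℝ) * x⌋ / q) / 2 - (y + ⌊(q:ℝ) * y⌋ / q) / 2| := by
  have hqp : (0 : ℝ) < q := by positivity
  wlog h : y ≤ x generalizing x y
  · have := this y x (by linarith)
    rw [abs_sub_comm, abs_sub_comm ((x + ⌊(q:ℝ) * x⌋ / q) / 2)]; exact this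
  have h1 : ⌊(q:ℝ) * y⌋ ≤ ⌊(q:ℝ) * x⌋ := Int.floor_le_floor (mul_le_mul_of_nonneg_left h hqp.le)
  have h2 : (⌊(q:ℝ) * y⌋ : ℝ) / q ≤ ⌊(q:ℝ) * x⌋ / q := by
    apply div_le_div_of_nonneg_right _ hqp.le
    exact_mod_cast h1
  rw [abs_of_nonneg (by linarith), abs_of_nonneg (by linarith)]
  linarith

lemma sigma_maps (q : ℕ) (hq : 0 < q) (x : ℝ) (hx : x ∈ Set.Ico (0:ℝ) 1) :
    (x + ⌊(q:ℝ) * x⌋ / q) / 2 ∈ Set.Ico (0:ℝ) 1 := by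
  have hqp : (0 : ℝ) < q := by positivity
  have h1 : (⌊(q:ℝ) * x⌋ : ℝ) / q ≤ x := by
    rw [div_le_iff₀ hqp]; have := Int.floor_le ((q:ℝ) * x); linarith
  have h2 : (0:ℝ) ≤ (⌊(q:ℝ) * x⌋ : ℝ) / q := by
    apply div_nonneg _ hqp.le
    have : 0 ≤ ⌊(q:ℝ) * x⌋ := Int.floor_nonneg.2 (mul_nonneg hqp.le hx.1)
    exact_mod_cast this
  constructor <;> linarith [hx.1, hx.2]

lemma sigma_fract (q : ℕ) (hq : 0 < q) (x : ℝ) :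
    Int.fract ((q:ℝ) * ((x + ⌊(q:ℝ) * x⌋ / q) / 2)) = Int.fract ((q:ℝ) * x) / 2 := by
  have hq0 : (q : ℝ) ≠ 0 := by positivity
  have h1 := Int.self_sub_floor ((q:ℝ) * x)
  have h2 : (q:ℝ) * ((x + ⌊(q:ℝ) * x⌋ / q) / 2) = Int.fract ((q:ℝ) * x) / 2 + ⌊(q:ℝ) * x⌋ := by
    field_simp; linarith
  rw [h2, Int.fract_add_intCast, Int.fract_eq_self]
  have f0 := Int.fract_nonneg ((q:ℝ) * x)
  have f1 := Int.fract_lt_one ((q:ℝ) * x)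
  constructor <;> linarith

lemma exists_step (n : ℕ) (s : Stage) (hs : s.L / s.q ≤ (1/2) ^ n) : ∃ s', Step n s s' := by
  obtain ⟨H, p, q, L, ell, hq, hpq, hL1, lF, lG, hell⟩ := s
  dsimp only at hs
  have hqp : (0 : ℝ) < q := by positivity
  have hq0 : (q : ℝ) ≠ 0 := by positivity
  have hL0 : 0 < L := by linarith
  have hell0 : 0 < ell := by linarith
  set δ : ℝ := (1/2) ^ n with hδdef
  have hδ : 0 < δ := by positivity
  have hδ1 : δ ≤ 1 := pow_le_one₀ (by norm_num) (by norm_num)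
  set g : ℝ := (1/4) ^ n / 64 with hgdef
  have h4 : (1/4 : ℝ) ^ n ≤ 1 := pow_le_one₀ (by norm_num) (by norm_num)
  have h40 : (0:ℝ) < (1/4 : ℝ) ^ n := by positivity
  have hg : 0 < g := by positivity
  have hg1 : g ≤ 1/64 := by rw [hgdef]; linarith
  obtain ⟨η, hη, hcov⟩ := exists_cov n H L q hL1 lF hq
  obtain ⟨w, hw, hwη, hwg⟩ : ∃ w : ℝ, 0 < w ∧ w ≤ η ∧ 80 * w ≤ g * δ :=
    ⟨min η (g * δ / 80), lt_min hη (by positivity), min_le_left _ _, by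
      have := min_le_right η (g * δ / 80); linarith⟩
  have hw16 : w < 1 / 16 := by nlinarith
  obtain ⟨d, hd, hdη, hd64, hd1, hd2⟩ : ∃ d : ℝ, 0 < d ∧ d ≤ η ∧ d ≤ 1/64 ∧ d * L ≤ δ ∧ 4 * ell * L * d ≤ δ / 32 := by
    refine ⟨min (min η (1/64)) (min (δ / L) (δ / (32 * (4 * ell * L)))), by positivity, ?_, ?_, ?_, ?_⟩
    · exact (min_le_left _ _).trans (min_le_left _ _)
    · exact (min_le_left _ _).trans (min_le_right _ _)
    · rw [← le_div_iff₀ hL0]; exact (min_le_right _ _).trans (min_le_left _ _)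
    · have : min (min η (1/64)) (min (δ / L) (δ / (32 * (4 * ell * L)))) ≤ δ / (32 * (4 * ell * L)) :=
        (min_le_right _ _).trans (min_le_right _ _)
      rw [le_div_iff₀ (by positivity)] at this
      linarith
  set K : ℝ := 32 / (w * (g * δ)) with hK
  have hκ : 32 ≤ K * w * (g * δ) := by
    rw [hK]; apply le_of_eq; field_simp
  obtain ⟨h, hcom, ⟨U, hUc, hUp, hUd, hU0, hU1⟩, hline, hbad⟩ := exists_h q hq w d K hw hw16 hd hd64
  set H' := H.comp h with hH'
  have hH'F : ∀ P, H'.F P = H.F (h.F P) := fun P => rfl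
  have hH'G : ∀ P, H'.G P = h.G (H.G P) := fun P => rfl
  obtain ⟨L', hL'1, lF', lG'⟩ := H'.lip
  have hL'0 : 0 < L' := by linarith
  obtain ⟨ηU, hηU, hUu⟩ := per_uc U hUc hUp (δ / L) (by positivity)
  -- identities
  have hid : ∀ (r : ℤ) P, H.F (H.G P + ((r / q : ℝ), 0)) = H'.F (H'.G P + ((r / q : ℝ), 0)) := by
    intro r P
    rw [hH'F, hH'G, hcom, h.FG]
  set β : ℕ → ℝ := fun m => 1 / ((q:ℝ) ^ 2 * m) with hβ
  have hlim : ∀ c : ℝ, ∀ ε > 0, ∀ᶠ m : ℕ in atTop, c / m < ε := by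
    intro c ε hε
    exact (tendsto_const_div_atTop_nhds_zero_nat c).eventually (gt_mem_nhds hε)
  have hβlim : Tendsto β atTop (𝓝 0) := by
    have := tendsto_const_div_atTop_nhds_zero_nat (1 / (q:ℝ)^2)
    refine this.congr (fun m => ?_)
    simp only [hβ]; rw [div_div]
  have hα1 : Tendsto (fun m => (p:ℝ) / q + β m) atTop (𝓝 ((p:ℝ) / q)) := by
    simpa using hβlim.const_add ((p:ℝ) / q)
  have hα2 : Tendsto (fun m => -((p:ℝ) / q + β m)) atTop (𝓝 (-((p:ℝ) / q))) := hα1.neg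
  have E1 : ∀ᶠ m in atTop, ∀ k ∈ Finset.range (n + 1), ∀ x, ‖iteratedFDeriv ℝ k
      (fun P => H'.F (H'.G P + ((p:ℝ) / q + β m, 0)) - H'.F (H'.G P + ((p:ℝ) / q, 0))) x‖ ≤ δ := by
    rw [eventually_all_finset]
    intro k _
    exact hα1.eventually (cnj_close H' ((p:ℝ)/q) k δ hδ)
  have E2 : ∀ᶠ m in atTop, ∀ k ∈ Finset.range (n + 1), ∀ x, ‖iteratedFDeriv ℝ k
      (fun P => H'.F (H'.G P + (-((p:ℝ) / q + β m), 0)) - H'.F (H'.G P + (-((p:ℝ) / q), 0))) x‖ ≤ δ := by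
    rw [eventually_all_finset]
    intro k _
    exact hα2.eventually (cnj_close H' (-((p:ℝ)/q)) k δ hδ)
  obtain ⟨m, hE1, hE2, hE3, hE4, hE5, hE6, hm⟩ := (E1.and (E2.and ((hlim (L' * 2 ^ (n+1) / q) δ hδ).and
    ((hlim (L' / q) δ hδ).and ((hlim (L' / q^2) ((1/2) ^ (n+1)) (by positivity)).and
    ((hlim 1 ηU hηU).and (eventually_gt_atTop 0))))))).exists
  have hmp : (0:ℝ) < m := by exact_mod_cast hm
  have hal : (((p * q * m + 1 : ℕ) : ℝ) / ((q ^ 2 * m : ℕ) : ℝ)) = p / q + β m := by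
    simp only [hβ]; push_cast; field_simp
  have hcop : Nat.Coprime (p * q * m + 1) (q ^ 2 * m) := by
    apply Nat.Coprime.mul_right
    · apply Nat.Coprime.pow_right
      have : p * q * m + 1 = 1 + q * (p * m) := by ring
      rw [this]
      simp
    · have : p * q * m + 1 = 1 + m * (p * q) := by ring
      rw [this]
      simp
  set s' : Stage := ⟨H', p * q * m + 1, q ^ 2 * m, L', max ell (7 * L'), by positivity, hcop, hL'1, lF', lG',
    le_max_right _ _⟩ with hs'
  set s : Stage := ⟨H, p, q, L, ell, hq, hpq, hL1, lF, lG, hell⟩ with hsdef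
  have hs'al : s'.al = p / q + β m := hal
  have hsal : s.al = p / q := rfl
  have hTs : ∀ P, s.T.F P = H'.F (H'.G P + ((p:ℝ) / q, 0)) := by
    intro P
    rw [Stage.T, cnj_F, hsal]
    exact hid p P
  have hTsG : ∀ P, s.T.G P = H'.F (H'.G P + (-((p:ℝ) / q), 0)) := by
    intro P
    rw [Stage.T, cnj_G, hsal]
    have := hid (-p) P
    push_cast at this
    rw [neg_div] at this
    exact this
  have hTs' : ∀ P, s'.T.F P = H'.F (H'.G P + ((p:ℝ) / q + β m, 0)) := by
    intro P
    rw [Stage.T, cnj_F, hs'al]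
  have hTs'G : ∀ P, s'.T.G P = H'.F (H'.G P + (-((p:ℝ) / q + β m), 0)) := by
    intro P
    rw [Stage.T, cnj_G, hs'al]
  have hge := generic_est H h L L' w d (K * w) g δ q p m U hL1 lF hq hpq hs hδ hcom hUc hUp hUd hU0 hU1 hd1
    lF' hL'0.le hm (by rw [← div_div]; exact hE4.le)
    (fun a b hab => by
      have := hUu a b (lt_of_le_of_lt hab hE6)
      rw [lt_div_iff₀ hL0] at this
      linarith) hw hw16 hg (by linarith) hwg hκ
  refine ⟨s', ?_, le_max_left _ _, ?_, ?_, ?_, ?_, ?_, ?_, ?_⟩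
  · change L' / ((q ^ 2 * m : ℕ) : ℝ) ≤ _
    push_cast
    rw [← div_div]; exact hE5.le
  · change q ≤ q ^ 2 * m
    nlinarith [Nat.mul_le_mul hq hm]
  · intro k hk x
    simp only [hTs, hTs']
    exact hE1 k (Finset.mem_range.2 (by omega)) x
  · intro k hk x
    simp only [hTsG, hTs'G]
    exact hE2 k (Finset.mem_range.2 (by omega)) x
  · intro j hj P
    rw [Stage.T, Stage.T, cnj_iter, cnj_iter, hsal, hs'al]
    have e1 : (j:ℝ) * ((p:ℝ) / q) = ((j * p : ℤ) : ℝ) / q := by push_cast; ring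
    have e2 : s.H.F (s.H.G P + ((j:ℝ) * ((p:ℝ) / q), 0)) = H'.F (H'.G P + ((j:ℝ) * ((p:ℝ) / q), 0)) := by
      rw [e1]; exact hid _ P
    rw [e2]
    refine (lF' _ _).trans ?_
    rw [dist_add_left, dist_pair, sub_self, abs_zero, max_eq_left (abs_nonneg _), mul_add, add_sub_cancel_left]
    have hβ0 : 0 ≤ β m := by simp only [hβ]; positivity
    rw [abs_of_nonneg (by positivity)]
    have hj' : (j:ℝ) ≤ 2 ^ (n+1) * q := by exact_mod_cast hj
    calc L' * (j * β m) ≤ L' * ((2 ^ (n+1) * q) * β m) := by gcongr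
      _ = L' * 2 ^ (n+1) / q / m := by simp only [hβ]; field_simp
      _ ≤ δ := hE3.le
  · obtain ⟨Z, hZ, hZP⟩ := hcov w d hw hwη hd hdη
    refine ⟨Z, hZ, ?_⟩
    intro P hP γ hγ hγ1 hγl
    have hP2 := hZP (H.G P) (by rw [H.FG]; exact hP)
    have := nongeneric_est H h L w d ell q hL1 lF hq hw hd hell0.le hbad (H.G P) hP2.1 hP2.2.1 hP2.2.2 γ hγ hγ1 hγl
    refine le_trans this ?_
    have e : (1/2 : ℝ) ^ (n + 4) = δ / 16 := by rw [pow_add, ← hδdef]; norm_num; ring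
    rw [e]
    nlinarith
  · refine ⟨{x | 4 * w ≤ Int.fract ((q:ℝ) * x) ∧ Int.fract ((q:ℝ) * x) ≤ 1 - 2 * w - 2 * g},
      fun x => (x + ⌊(q:ℝ) * x⌋ / q) / 2, ?_, fun x hx => sigma_maps q hq x hx, sigma_anti q hq, ?_, ?_⟩
    · refine le_trans (measure_mono ?_) ((vol_fract q hq (4 * w) (1 - 2 * w - 2 * g) (by linarith) (by linarith)).trans ?_)
      · rintro x ⟨hx, hx2⟩
        exact ⟨hx.1, hx.2, hx2⟩
      · apply ENNReal.ofReal_le_ofReal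
        have : (1/4 : ℝ) ^ n = 64 * g := by rw [hgdef]; ring
        rw [this]
        nlinarith
    · rintro x ⟨h1, h2⟩
      change H.F (h.F _) = H.F _
      rw [hline x h1 (by linarith)]
    · rintro x ⟨h1, h2⟩ f C ω hf hfp hfC hfω N hN
      have h3 := sigma_fract q hq x
      have := (hge f hf hfp C ω hfC hfω).1 ((x + ⌊(q:ℝ) * x⌋ / q) / 2) (by rw [h3]; linarith) (by rw [h3]; linarith) N hN
      rw [hs'al]
      exact this
  · intro f C ω hf hfp hfC hfω
    exact (hge f hf hfp C ω hfC hfω).2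

def stage0 : Stage where
  H := Lft.id
  p := 0
  q := 1
  L := 1
  ell := 7
  hq := one_pos
  hpq := by simp
  hL1 := le_rfl
  lF := fun a b => by
    have : ∀ a, Lft.id.F a = a := fun a => by simp [Lft.id]
    rw [this, this, one_mul]
  lG := fun a b => by
    have : ∀ a, Lft.id.G a = a := fun a => by simp [Lft.id]
    rw [this, this, one_mul]
  hell := by norm_num

lemma exists_seq : ∃ s : ℕ → Stage, s 0 = stage0 ∧ ∀ n, Step n (s n) (s (n + 1)) := by
  choose! nx hnx using exists_step
  set s : ℕ → Stage := fun n => Nat.rec stage0 (fun n t => nx n t) n with hs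
  have hsucc : ∀ n, s (n + 1) = nx n (s n) := fun n => rfl
  have hL : ∀ n, (s n).L / (s n).q ≤ (1/2) ^ n := by
    intro n
    induction n with
    | zero => simp [hs, stage0]
    | succ n ih =>
      rw [hsucc]
      exact (hnx n (s n) ih).sm
  refine ⟨s, rfl, fun n => ?_⟩
  rw [hsucc]; exact hnx n (s n) (hL n)


lemma per2_uc (f : ℝ × ℝ → ℝ) (hf : Continuous f) (pf : Per f) (ε : ℝ) (hε : 0 < ε) :
    ∃ η > 0, ∀ a b, dist a b < η → |f a - f b| < ε := by
  have hK : IsCompact (Set.Icc (-1:ℝ) 2 ×ˢ Set.Icc (-1:ℝ) 2) := isCompact_Icc.prod isCompact_Icc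
  have hu := hK.uniformContinuousOn_of_continuous hf.continuousOn
  rw [Metric.uniformContinuousOn_iff] at hu
  obtain ⟨η, hη, h⟩ := hu ε hε
  refine ⟨min η 1, by positivity, fun a b hab => ?_⟩
  obtain ⟨a0, m, ha0, rfl⟩ := exists_unit a
  have e : b = (b - ((m.1:ℝ), (m.2:ℝ))) + ((m.1:ℝ), (m.2:ℝ)) := by simp
  set b0 := b - ((m.1:ℝ), (m.2:ℝ)) with hb0
  rw [e, pf, pf]
  rw [e, dist_add_right] at hab
  have h1 := lt_of_lt_of_le hab (min_le_right _ _)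
  rw [← Real.dist_eq]
  obtain ⟨⟨x1, x2⟩, ⟨y1, y2⟩⟩ := ha0
  rw [Prod.dist_eq, max_lt_iff, Real.dist_eq, Real.dist_eq, abs_lt, abs_lt] at h1
  refine h a0 ⟨⟨by linarith, by linarith⟩, ⟨by linarith, by linarith⟩⟩ b0 ⟨⟨?_, ?_⟩, ⟨?_, ?_⟩⟩ (lt_of_lt_of_le hab (min_le_left _ _)) <;>
  linarith [h1.1.1, h1.1.2, h1.2.1, h1.2.2]

lemma per2_bdd (f : ℝ × ℝ → ℝ) (hf : Continuous f) (pf : Per f) : ∃ C, 0 < C ∧ ∀ a, |f a| ≤ C := by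
  have hK : IsCompact (Set.Icc (0:ℝ) 1 ×ˢ Set.Icc (0:ℝ) 1) := isCompact_Icc.prod isCompact_Icc
  obtain ⟨C, hC⟩ := hK.exists_bound_of_continuousOn hf.continuousOn
  refine ⟨|C| + 1, by positivity, fun a => ?_⟩
  obtain ⟨a0, m, ha0, rfl⟩ := exists_unit a
  rw [pf]
  have := hC a0 ha0
  rw [Real.norm_eq_abs] at this
  linarith [le_abs_self C]

lemma I2_close (f g : ℝ × ℝ → ℝ) (hf : Continuous f) (hg : Continuous g) (C : ℝ) (h : ∀ x, |f x - g x| ≤ C) :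
    |I2 f - I2 g| ≤ C := by
  unfold I2
  apply abs_integral01_sub_le
  · exact intervalIntegral.continuous_parametric_intervalIntegral_of_continuous' (by fun_prop) _ _
  · exact intervalIntegral.continuous_parametric_intervalIntegral_of_continuous' (by fun_prop) _ _
  · intro x
    apply abs_integral01_sub_le
    · fun_prop
    · fun_prop
    · intro y; exact h _

lemma half_geom_dist {X : Type*} [PseudoMetricSpace X] (f : ℕ → X) (a : X) (n : ℕ)
    (h : ∀ m ≥ n, dist (f m) (f (m+1)) ≤ (1/2:ℝ)^m) (hl : Tendsto f atTop (𝓝 a)) :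
    dist (f n) a ≤ 2 * (1/2)^n := by
  have h1 : ∀ k, dist (f (n + k)) (f (n + (k + 1))) ≤ (1/2:ℝ)^n * (1/2)^k := by
    intro k
    rw [← pow_add]; exact h (n + k) (by omega)
  have hl' : Tendsto (fun k => f (n + k)) atTop (𝓝 a) := by
    have := (tendsto_add_atTop_iff_nat n).2 hl
    simpa [add_comm] using this
  have := dist_le_of_le_geometric_of_tendsto (1/2) ((1/2)^n) (by norm_num) h1 hl' 0
  simp only [add_zero, pow_zero, mul_one] at this
  refine this.trans (le_of_eq ?_)
  ring

lemma smooth_limit (F : ℕ → ℝ × ℝ → ℝ × ℝ) (hF : ∀ n, ContDiff ℝ (⊤ : ℕ∞) (F n))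
    (hd : ∀ n, ∀ k ≤ n, ∀ x, ‖iteratedFDeriv ℝ k (fun P => F (n+1) P - F n P) x‖ ≤ (1/2)^n) :
    ∃ A : ℝ × ℝ → ℝ × ℝ, ContDiff ℝ (⊤ : ℕ∞) A ∧ (∀ n x, dist (F n x) (A x) ≤ 2 * (1/2)^n) ∧
      ∀ x, Tendsto (fun n => F n x) atTop (𝓝 (A x)) := by
  have hs : Summable (fun n : ℕ => (1/2:ℝ)^n) := summable_geometric_two
  have h0 : ∀ n x, dist (F n x) (F (n+1) x) ≤ (1/2)^n := by
    intro n x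
    have := hd n 0 (Nat.zero_le _) x
    rw [norm_iteratedFDeriv_zero] at this
    rw [dist_comm, dist_eq_norm]; exact this
  have hA : ContDiff ℝ (⊤ : ℕ∞) (fun x => ∑' n, (F (n+1) x - F n x)) := by
    refine contDiff_tsum_of_eventually (v := fun _ n => (1/2:ℝ)^n) (fun i => (hF _).sub (hF _)) (fun _ _ => hs) ?_
    intro k _
    rw [Nat.cofinite_eq_atTop]
    filter_upwards [eventually_ge_atTop k] with n hn x
    exact hd n k hn x
  have hl : ∀ x, Tendsto (fun n => F n x) atTop (𝓝 (F 0 x + ∑' n, (F (n+1) x - F n x))) := by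
    intro x
    have hsm : Summable (fun n => F (n+1) x - F n x) := by
      apply Summable.of_norm_bounded hs
      intro n
      rw [← dist_eq_norm, dist_comm]; exact h0 n x
    have := (hsm.hasSum.tendsto_sum_nat).const_add (F 0 x)
    refine this.congr (fun n => ?_)
    rw [Finset.sum_range_sub (fun n => F n x)]; simp
  refine ⟨fun x => F 0 x + ∑' n, (F (n+1) x - F n x), (hF 0).add hA, ?_, hl⟩
  intro n x
  exact half_geom_dist (fun n => F n x) _ n (fun m _ => h0 m x) (hl x)

lemma half_tendsto : Tendsto (fun n : ℕ => 2 * (1/2:ℝ)^n) atTop (𝓝 0) := by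
  simpa using (tendsto_pow_atTop_nhds_zero_of_lt_one (by norm_num : (0:ℝ) ≤ 1/2) (by norm_num)).const_mul 2

lemma unif_comp (F : ℕ → ℝ × ℝ → ℝ × ℝ) (A : ℝ × ℝ → ℝ × ℝ) (hA : Continuous A)
    (hd : ∀ n x, dist (F n x) (A x) ≤ 2 * (1/2)^n) (u : ℕ → ℝ × ℝ) (v : ℝ × ℝ) (hu : Tendsto u atTop (𝓝 v)) :
    Tendsto (fun n => F n (u n)) atTop (𝓝 (A v)) := by
  have h1 : Tendsto (fun n => A (u n)) atTop (𝓝 (A v)) := (hA.tendsto v).comp hu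
  refine (tendsto_iff_of_dist ?_).2 h1
  exact squeeze_zero (fun _ => dist_nonneg) (fun n => hd n (u n)) half_tendsto

lemma exists_limit (s : ℕ → Stage) (hs : ∀ n, Step n (s n) (s (n+1))) :
    ∃ A : Lft, ∀ n j, j ≤ 2^(n+1) * (s n).q → ∀ P, dist ((s n).T.F^[j] P) (A.F^[j] P) ≤ 2 * (1/2)^n := by
  obtain ⟨F, cF, dF, tF⟩ := smooth_limit (fun n => (s n).T.F) (fun n => (s n).T.hF) (fun n => (hs n).dF)
  obtain ⟨G, cG, dG, tG⟩ := smooth_limit (fun n => (s n).T.G) (fun n => (s n).T.hG) (fun n => (hs n).dG)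
  have eF : IntEquivariant F := by
    intro p m
    refine tendsto_nhds_unique (tF _) ?_
    have e : ∀ n, (s n).T.F (p + ((m.1:ℝ), (m.2:ℝ))) = (s n).T.F p + ((m.1:ℝ), (m.2:ℝ)) := fun n => (s n).T.eF p m
    simp only [e]
    exact (tF p).add_const _
  have eG : IntEquivariant G := by
    intro p m
    refine tendsto_nhds_unique (tG _) ?_
    have e : ∀ n, (s n).T.G (p + ((m.1:ℝ), (m.2:ℝ))) = (s n).T.G p + ((m.1:ℝ), (m.2:ℝ)) := fun n => (s n).T.eG p m
    simp only [e]
    exact (tG p).add_const _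
  refine ⟨⟨F, G, cF, cG, eF, eG, ?_, ?_, ?_⟩, ?_⟩
  · intro p
    refine tendsto_nhds_unique (unif_comp _ F cF.continuous dF _ _ (tG p)) ?_
    simp only [(s _).T.FG]
    exact tendsto_const_nhds
  · intro p
    refine tendsto_nhds_unique (unif_comp _ G cG.continuous dG _ _ (tF p)) ?_
    simp only [(s _).T.GF]
    exact tendsto_const_nhds
  · intro f hf pf
    apply eq_of_forall_dist_le
    intro ε hε
    obtain ⟨η, hη, h⟩ := per2_uc f hf pf ε hε
    obtain ⟨n, hn⟩ := (half_tendsto.eventually (gt_mem_nhds hη)).exists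
    rw [← (s n).T.mp f hf pf, Real.dist_eq]
    apply I2_close _ _ (hf.comp cF.continuous) (hf.comp (s n).T.hF.continuous)
    intro x
    refine (h _ _ ?_).le
    rw [dist_comm]
    exact lt_of_le_of_lt (dF n x) hn
  · intro n j hj P
    have hq : ∀ m ≥ n, j ≤ 2^(m+1) * (s m).q := by
      intro m hm
      induction m, hm using Nat.le_induction with
      | base => exact hj
      | succ m hm ih =>
        refine ih.trans (Nat.mul_le_mul (Nat.pow_le_pow_right (by norm_num) (by omega)) (hs m).qq)
    have ht : ∀ j, Tendsto (fun m => (s m).T.F^[j] P) atTop (𝓝 (F^[j] P)) := by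
      intro j
      induction j with
      | zero => exact tendsto_const_nhds
      | succ j ih =>
        simp only [Function.iterate_succ_apply']
        exact unif_comp _ F cF.continuous dF _ _ ih
    refine half_geom_dist (fun m => (s m).T.F^[j] P) _ n (fun m hm => ?_) (ht j)
    rw [dist_comm]
    exact (hs m).it j (hq m hm) P


lemma torusProj_quot : IsOpenQuotientMap torusProj := by
  have h : IsOpenQuotientMap ((↑) : ℝ → UnitAddCircle) := QuotientAddGroup.isOpenQuotientMap_mk
  exact h.prodMap h

lemma torusProj_eq {P Q : ℝ × ℝ} (h : torusProj P = torusProj Q) :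
    ∃ m : ℤ × ℤ, P = Q + ((m.1:ℝ), (m.2:ℝ)) := by
  have key : ∀ x y : ℝ, (x : UnitAddCircle) = y → ∃ k : ℤ, x = y + k := by
    intro x y hxy
    have := (QuotientAddGroup.eq_iff_sub_mem (N := AddSubgroup.zmultiples (1:ℝ))).1 hxy
    obtain ⟨k, hk⟩ := AddSubgroup.mem_zmultiples_iff.1 this
    refine ⟨k, ?_⟩
    simp at hk
    linarith
  obtain ⟨a, ha⟩ := key P.1 Q.1 (congrArg Prod.fst h)
  obtain ⟨b, hb⟩ := key P.2 Q.2 (congrArg Prod.snd h)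
  refine ⟨(a, b), ?_⟩
  ext <;> simp [ha, hb]

/-- descend an equivariant map to the torus -/
def desc (F : ℝ × ℝ → ℝ × ℝ) (x : Torus2) : Torus2 := torusProj (F (Function.surjInv torusProj_quot.surjective x))

lemma desc_proj {F : ℝ × ℝ → ℝ × ℝ} (eF : IntEquivariant F) (P : ℝ × ℝ) : desc F (torusProj P) = torusProj (F P) := by
  unfold desc
  obtain ⟨m, hm⟩ := torusProj_eq (Function.surjInv_eq torusProj_quot.surjective (torusProj P))
  rw [hm, eF, torusProj_add]

lemma per_proj (f : Torus2 → ℝ) : Per (fun P => f (torusProj P)) := by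
  intro p m
  beta_reduce
  rw [torusProj_add]

lemma int_torus (f : C(Torus2, ℝ)) : ∫ y, f y = I2 (fun P => f (torusProj P)) := by
  have hi : Integrable f ((volume : Measure UnitAddCircle).prod (volume : Measure UnitAddCircle)) :=
    f.continuous.integrable_of_hasCompactSupport (HasCompactSupport.of_compactSpace _)
  change ∫ y, f y ∂((volume : Measure UnitAddCircle).prod (volume : Measure UnitAddCircle)) = _
  rw [integral_prod _ hi]
  unfold I2 torusProj
  have h1 := UnitAddCircle.intervalIntegral_preimage 0 (fun x => ∫ y, f (x, y))
  rw [zero_add] at h1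
  rw [← h1]
  congr 1; ext x
  have h2 := UnitAddCircle.intervalIntegral_preimage 0 (fun y => f ((x : UnitAddCircle), y))
  rw [zero_add] at h2
  rw [← h2]

def toDiffeo (A : Lft) : SmoothMPTorusDiffeo where
  toEquiv :=
    { toFun := desc A.F
      invFun := desc A.G
      left_inv := fun x => by
        obtain ⟨P, rfl⟩ := torusProj_quot.surjective x
        rw [desc_proj A.eF, desc_proj A.eG, A.GF]
      right_inv := fun x => by
        obtain ⟨P, rfl⟩ := torusProj_quot.surjective x
        rw [desc_proj A.eG, desc_proj A.eF, A.FG] }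
  lift := A.F
  liftInv := A.G
  lift_contDiff := A.hF
  liftInv_contDiff := A.hG
  lift_equivariant := A.eF
  liftInv_equivariant := A.eG
  lift_isLift := fun p => (desc_proj A.eF p).symm
  liftInv_isLift := fun p => (desc_proj A.eG p).symm
  measurePreserving := by
    have hc : Continuous (desc A.F) := by
      rw [torusProj_quot.isQuotientMap.continuous_iff]
      have : desc A.F ∘ torusProj = fun P => torusProj (A.F P) := funext (desc_proj A.eF)
      rw [this]
      exact torusProj_quot.continuous.comp A.hF.continuous
    refine ⟨hc.measurable, ?_⟩
    change Measure.map (desc A.F) volume = volume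
    haveI : IsFiniteMeasure (Measure.map (desc A.F) (volume : Measure Torus2)) := inferInstance
    apply ext_of_forall_integral_eq_of_IsFiniteMeasure
    intro f
    rw [integral_map hc.measurable.aemeasurable f.continuous.aestronglyMeasurable]
    have h1 := int_torus f.toContinuousMap
    have h2 := int_torus ⟨fun y => f (desc A.F y), f.continuous.comp hc⟩
    refine Eq.trans h2 (Eq.trans ?_ h1.symm)
    have h3 := A.mp (fun P => f (torusProj P)) (f.continuous.comp torusProj_quot.continuous) (per_proj f)
    refine Eq.trans ?_ h3
    congr 1
    ext P
    change f (desc A.F (torusProj P)) = _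
    rw [desc_proj A.eF]

lemma toDiffeo_iter (A : Lft) (j : ℕ) (P : ℝ × ℝ) :
    (toDiffeo A).toEquiv^[j] (torusProj P) = torusProj (A.F^[j] P) := by
  induction j with
  | zero => rfl
  | succ j ih =>
    rw [Function.iterate_succ_apply', Function.iterate_succ_apply', ih]
    exact desc_proj A.eF _

/-- continuous periodic functions descend -/
lemma exists_desc (g : ℝ × ℝ → ℝ) (hg : Continuous g) (pg : Per g) : ∃ f : C(Torus2, ℝ), ∀ P, f (torusProj P) = g P := by
  have h : ∀ P, g (Function.surjInv torusProj_quot.surjective (torusProj P)) = g P := by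
    intro P
    obtain ⟨m, hm⟩ := torusProj_eq (Function.surjInv_eq torusProj_quot.surjective (torusProj P))
    rw [hm, pg]
  refine ⟨⟨fun x => g (Function.surjInv torusProj_quot.surjective x), ?_⟩, h⟩
  rw [torusProj_quot.isQuotientMap.continuous_iff]
  exact hg.congr (fun P => (h P).symm)

lemma generic_iff (A : Lft) (P : ℝ × ℝ) : IsGenericPt (toDiffeo A).toEquiv volume (torusProj P) ↔
    ∀ g : ℝ × ℝ → ℝ, Continuous g → Per g → Tendsto (fun N : ℕ => (N:ℝ)⁻¹ * ∑ j ∈ Finset.range N, g (A.F^[j] P))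
      atTop (𝓝 (I2 g)) := by
  constructor
  · intro h g hg pg
    obtain ⟨f, hf⟩ := exists_desc g hg pg
    have := h f
    rw [int_torus] at this
    simpa only [toDiffeo_iter, hf] using this
  · intro h f
    rw [int_torus]
    simp only [toDiffeo_iter]
    exact h (fun P => f (torusProj P)) (f.continuous.comp torusProj_quot.continuous) (per_proj f)


lemma stage_pow_le (s : ℕ → Stage) (h0 : s 0 = stage0) (hs : ∀ n, Step n (s n) (s (n+1))) (n : ℕ) :
    (s n).L / (s n).q ≤ (1/2)^n := by
  cases n with
  | zero => rw [h0]; simp [stage0]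
  | succ n => exact (hs n).sm

lemma err_small (s : ℕ → Stage) (hs : ∀ n, Step n (s n) (s (n+1)))
    (f : ℝ × ℝ → ℝ) (hf : Continuous f) (pf : Per f) (C : ℝ) (hC : ∀ x, |f x| ≤ C) (ε : ℝ) (hε : 0 < ε) :
    ∃ n0, ∀ n ≥ n0, (s n).err f ≤ 7 * ε ∧ (∀ a b, dist a b ≤ 2 * (1/2)^n → |f a - f b| ≤ ε) ∧ C * (1/2)^n ≤ ε := by
  obtain ⟨η, hη, hu⟩ := per2_uc f hf pf ε hε
  have h1 := half_tendsto.eventually (gt_mem_nhds hη)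
  have h2 : ∀ᶠ n : ℕ in atTop, C * (1/2)^n < ε := by
    have := (tendsto_pow_atTop_nhds_zero_of_lt_one (by norm_num : (0:ℝ) ≤ 1/2) (by norm_num)).const_mul C
    rw [mul_zero] at this
    exact this.eventually (gt_mem_nhds hε)
  obtain ⟨n1, hn1⟩ := eventually_atTop.1 (h1.and h2)
  have hrec : ∀ k, (s (n1 + k)).err f ≤ (s n1).err f * (1/2)^k + 6 * ε := by
    intro k
    induction k with
    | zero => simp; linarith
    | succ k ih =>
      have a1 := hn1 (n1 + k) (by omega)
      have := (hs (n1 + k)).av f C ε hf pf hC (fun a b hab => (hu a b (by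
        have : (0:ℝ) < (1/2)^(n1+k) := by positivity
        linarith [a1.1])).le)
      have e : n1 + (k + 1) = n1 + k + 1 := by ring
      rw [e, pow_succ]
      linarith [a1.2]
  have h3 : ∀ᶠ k : ℕ in atTop, (s n1).err f * (1/2)^k < ε := by
    have := (tendsto_pow_atTop_nhds_zero_of_lt_one (by norm_num : (0:ℝ) ≤ 1/2) (by norm_num)).const_mul ((s n1).err f)
    rw [mul_zero] at this
    exact this.eventually (gt_mem_nhds hε)
  obtain ⟨k1, hk1⟩ := eventually_atTop.1 h3
  refine ⟨n1 + k1, fun n hn => ?_⟩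
  obtain ⟨k, rfl⟩ : ∃ k, n = n1 + k := ⟨n - n1, by omega⟩
  have a1 := hn1 (n1 + k) (by omega)
  have a2 := hk1 k (by omega)
  exact ⟨by linarith [hrec k], fun a b hab => (hu a b (by linarith [a1.1])).le, a1.2.le⟩

lemma find_scale (a : ℕ → ℕ) (ha : ∀ n, n < a n) (n0 N : ℕ) (h : a n0 ≤ N) : ∃ n ≥ n0, a n ≤ N ∧ N < a (n+1) := by
  by_contra hcon
  push Not at hcon
  have : ∀ n ≥ n0, a n ≤ N := by
    intro n hn
    induction n, hn using Nat.le_induction with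
    | base => exact h
    | succ n hn ih => exact hcon n hn ih
  have h1 := this (n0 + N) (by omega)
  have h2 := ha (n0 + N)
  omega

lemma avg_close (N : ℕ) (u v : ℕ → ℝ) (ε : ℝ) (hε : 0 ≤ ε) (h : ∀ j < N, |u j - v j| ≤ ε) :
    |(N:ℝ)⁻¹ * (∑ j ∈ Finset.range N, u j) - (N:ℝ)⁻¹ * ∑ j ∈ Finset.range N, v j| ≤ ε := by
  rcases Nat.eq_zero_or_pos N with rfl | hN
  · simpa using hε
  have hN' : (0:ℝ) < N := by exact_mod_cast hN
  rw [← mul_sub, ← Finset.sum_sub_distrib, abs_mul, abs_of_pos (inv_pos.2 hN')]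
  rw [inv_mul_le_iff₀ hN']
  refine (Finset.abs_sum_le_sum_abs _ _).trans ?_
  refine (Finset.sum_le_card_nsmul _ _ ε (fun j hj => h j (Finset.mem_range.1 hj))).trans ?_
  simp

lemma lower_bound (s : ℕ → Stage) (h0 : s 0 = stage0) (hs : ∀ n, Step n (s n) (s (n+1))) (A : Lft)
    (hA : ∀ n j, j ≤ 2^(n+1) * (s n).q → ∀ P, dist ((s n).T.F^[j] P) (A.F^[j] P) ≤ 2 * (1/2)^n) :
    1 ≤ dimH {x : Torus2 | IsGenericPt (toDiffeo A).toEquiv volume x} := by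
  choose J σ hvol hmap hanti hline hgen using fun n => (hs n).gen
  set S : ℕ → ℝ → ℝ := fun n x => Nat.rec x (fun n t => σ n t) n with hS
  have S0 : ∀ x, S 0 x = x := fun x => rfl
  have S1 : ∀ n x, S (n+1) x = σ n (S n x) := fun n x => rfl
  set Γ : Set ℝ := {x | x ∈ Set.Ico (0:ℝ) (1/2) ∧ ∀ n, S n x ∈ J n} with hΓ
  have hSmap : ∀ n, ∀ x ∈ Set.Ico (0:ℝ) 1, S n x ∈ Set.Ico (0:ℝ) 1 := by
    intro n x hx
    induction n with
    | zero => exact hx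
    | succ n ih => exact hmap n _ ih
  have hSanti : ∀ n, AntilipschitzWith (2^n) (S n) := by
    intro n
    apply AntilipschitzWith.of_le_mul_dist
    intro x y
    induction n with
    | zero => simp [S0]
    | succ n ih =>
      rw [S1, S1, pow_succ]
      have := hanti n (S n x) (S n y)
      rw [← Real.dist_eq, ← Real.dist_eq] at this
      push_cast at ih ⊢
      refine ih.trans ?_
      rw [mul_assoc]
      gcongr
  have hpre : ∀ n, volume (S n ⁻¹' (Set.Ico 0 1 \ J n)) ≤ ENNReal.ofReal (1/8 * (1/2)^n) := by
    intro n
    have h1 := (hSanti n).hausdorffMeasure_preimage_le (d := 1) zero_le_one (Set.Ico 0 1 \ J n)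
    rw [hausdorffMeasure_real] at h1
    refine h1.trans ?_
    rw [ENNReal.rpow_one]
    refine (mul_le_mul_right (hvol n) _).trans ?_
    have e : (((2:NNReal)^n : NNReal) : ℝ≥0∞) = ENNReal.ofReal (2^n) := by
      rw [ENNReal.ofReal_pow (by norm_num)]; simp
    rw [e, ← ENNReal.ofReal_mul (by positivity)]
    apply ENNReal.ofReal_le_ofReal
    apply le_of_eq
    have : (1/4:ℝ)^n = (1/2)^n * (1/2)^n := by rw [← mul_pow]; norm_num
    rw [this]
    have h2 : (2:ℝ)^n * (1/2)^n = 1 := by rw [← mul_pow]; norm_num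
    linear_combination (1/8 * (1/2)^n) * h2
  have hcov : Set.Ico (0:ℝ) (1/2) ⊆ Γ ∪ ⋃ n, S n ⁻¹' (Set.Ico 0 1 \ J n) := by
    intro x hx
    by_cases h : ∀ n, S n x ∈ J n
    · exact Or.inl ⟨hx, h⟩
    · push Not at h
      obtain ⟨n, hn⟩ := h
      exact Or.inr (Set.mem_iUnion.2 ⟨n, hSmap n x ⟨hx.1, by linarith [hx.2]⟩, hn⟩)
  have hΓ0 : volume Γ ≠ 0 := by
    intro hz
    have h1 := (measure_mono hcov).trans (measure_union_le (μ := volume) _ _)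
    rw [hz, zero_add, Real.volume_Ico] at h1
    have h2 := (h1.trans (measure_iUnion_le _)).trans (ENNReal.tsum_le_tsum hpre)
    rw [← ENNReal.ofReal_tsum_of_nonneg (fun n => by positivity) (summable_geometric_two.mul_left _), tsum_mul_left,
      tsum_geometric_two] at h2
    rw [ENNReal.ofReal_le_ofReal_iff (by norm_num)] at h2
    norm_num at h2
  have hline' : ∀ x ∈ Γ, ∀ n, (s n).H.F (S n x, 1/2) = (x, 1/2) := by
    intro x hx n
    induction n with
    | zero => rw [h0]; simp [stage0, Lft.id, S0]
    | succ n ih => rw [S1, hline n _ (hx.2 n), ih]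
  have ha : ∀ n, n < 2^n * (s n).q := by
    intro n
    calc n < 2^n := Nat.lt_two_pow_self
      _ ≤ 2^n * (s n).q := Nat.le_mul_of_pos_right _ (s n).hq
  have hgeneric : ∀ x ∈ Γ, IsGenericPt (toDiffeo A).toEquiv volume (torusProj (x, 1/2)) := by
    intro x hx
    rw [generic_iff]
    intro f hf pf
    obtain ⟨C, hC0, hC⟩ := per2_bdd f hf pf
    rw [Metric.tendsto_atTop]
    intro ε' hε'
    set ε := ε' / 16 with hε
    have hε0 : 0 < ε := by positivity
    obtain ⟨n0, hn0⟩ := err_small s hs f hf pf C hC ε hε0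
    refine ⟨2^n0 * (s n0).q, fun N hN => ?_⟩
    obtain ⟨n, hn, hnN, hNn⟩ := find_scale (fun n => 2^n * (s n).q) ha n0 N hN
    obtain ⟨b1, b2, b3⟩ := hn0 n hn
    obtain ⟨_, b2', _⟩ := hn0 (n+1) (by omega)
    have hp : (0:ℝ) < (1/2)^n := by positivity
    have hNq : ((s n).q : ℝ) ≤ N * (1/2)^n := by
      have h1 : (2:ℝ)^n * (s n).q ≤ N := by exact_mod_cast hnN
      have h2 : (2:ℝ)^n * (1/2)^n = 1 := by rw [← mul_pow]; norm_num
      calc ((s n).q : ℝ) = (2^n * (s n).q) * (1/2)^n := by linear_combination -((s n).q : ℝ) * h2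
        _ ≤ _ := by gcongr
    have c1 := hgen n (S n x) (hx.2 n) f C ε hf pf hC (fun a b hab => b2 a b (by linarith)) N hNq
    have hit : ∀ j : ℕ, (s (n+1)).T.F^[j] (x, 1/2) = (s (n+1)).H.F (σ n (S n x) + j * (s (n+1)).al, 1/2) := by
      intro j
      rw [Stage.T, cnj_iter, ← hline' x hx (n+1), (s (n+1)).H.GF, S1]
      simp
    have c2 := avg_close N (fun j => f (A.F^[j] (x, 1/2))) (fun j => f ((s (n+1)).H.F (σ n (S n x) + j * (s (n+1)).al, 1/2)))
      ε hε0.le (fun j hj => by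
        beta_reduce
        rw [← hit, abs_sub_comm]
        apply b2'
        apply hA (n+1) j
        have : 2^(n+1) * (s (n+1)).q ≤ 2^(n+1+1) * (s (n+1)).q :=
          Nat.mul_le_mul_right _ (Nat.pow_le_pow_right (by norm_num) (by omega))
        omega)
    rw [Real.dist_eq]
    have c3 := abs_sub_le ((N:ℝ)⁻¹ * ∑ j ∈ Finset.range N, f (A.F^[j] (x, 1/2))) _ (I2 f) |>.trans (add_le_add c2 c1)
    refine lt_of_le_of_lt c3 ?_
    rw [mul_assoc]
    linarith
  set E : Set Torus2 := (fun x : ℝ => torusProj (x, 1/2)) '' Γ with hE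
  have hEsub : E ⊆ {x : Torus2 | IsGenericPt (toDiffeo A).toEquiv volume x} := by
    rintro _ ⟨x, hx, rfl⟩
    exact hgeneric x hx
  have hdist : ∀ x ∈ Γ, ∀ y ∈ Γ, dist x y ≤ dist (torusProj (x, 1/2)) (torusProj (y, 1/2)) := by
    intro x hx y hy
    refine le_trans ?_ (le_max_left _ _)
    change _ ≤ dist (x : UnitAddCircle) (y : UnitAddCircle)
    rw [dist_eq_norm (x : UnitAddCircle), ← AddCircle.coe_sub, (AddCircle.norm_coe_eq_abs_iff (1:ℝ) one_ne_zero).2]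
    · rfl
    · rw [abs_one, abs_le]
      constructor <;> linarith [hx.1.1, hx.1.2, hy.1.1, hy.1.2]
  set φ : Torus2 → ℝ := Function.invFunOn (fun x : ℝ => torusProj (x, 1/2)) Γ with hφ
  have hφ1 : ∀ t ∈ E, φ t ∈ Γ ∧ torusProj (φ t, 1/2) = t := by
    intro t ht
    exact ⟨Function.invFunOn_mem ht, Function.invFunOn_eq ht⟩
  have hlip : LipschitzOnWith 1 φ E := by
    apply LipschitzOnWith.of_dist_le_mul
    intro t ht u hu
    have h1 := hφ1 t ht
    have h2 := hφ1 u hu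
    have := hdist _ h1.1 _ h2.1
    rw [h1.2, h2.2] at this
    simpa using this
  have himg : Γ ⊆ φ '' E := by
    intro x hx
    have hxE : torusProj (x, 1/2) ∈ E := ⟨x, hx, rfl⟩
    refine ⟨_, hxE, ?_⟩
    have h1 := hφ1 _ hxE
    have := hdist _ h1.1 x hx
    rw [h1.2, dist_self] at this
    exact dist_le_zero.1 this
  have hΓdim : 1 ≤ dimH Γ := by
    have := le_dimH_of_hausdorffMeasure_ne_zero (s := Γ) (d := 1) (by
      rw [NNReal.coe_one, hausdorffMeasure_real]; exact hΓ0)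
    simpa using this
  calc 1 ≤ dimH Γ := hΓdim
    _ ≤ dimH (φ '' E) := dimH_mono himg
    _ ≤ dimH E := hlip.dimH_image_le
    _ ≤ _ := dimH_mono hEsub


lemma int_cos_shift (c : ℝ) : ∫ y in (0:ℝ)..1, Real.cos (2 * Real.pi * (y - c)) = 0 := by
  have h := intervalIntegral.integral_eq_sub_of_hasDerivAt (a := 0) (b := 1)
    (f := fun y : ℝ => Real.sin (2 * Real.pi * (y - c)) / (2 * Real.pi))
    (f' := fun y : ℝ => Real.cos (2 * Real.pi * (y - c))) (fun y _ => by
      have h1 : HasDerivAt (fun y : ℝ => 2 * Real.pi * (y - c)) (2 * Real.pi) y := by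
        simpa using ((hasDerivAt_id y).sub_const c).const_mul (2 * Real.pi)
      have h2 := h1.sin.div_const (2 * Real.pi)
      rw [mul_div_cancel_right₀ _ Real.two_pi_pos.ne'] at h2
      exact h2) (Continuous.intervalIntegrable (by fun_prop) _ _)
  rw [h]
  have : 2 * Real.pi * (1 - c) = 2 * Real.pi * (0 - c) + 2 * Real.pi := by ring
  rw [this, Real.sin_add_two_pi, sub_self]

lemma generic_bad (s : ℕ → Stage) (h0 : s 0 = stage0) (hs : ∀ n, Step n (s n) (s (n+1))) (A : Lft)
    (hA : ∀ n j, j ≤ 2^(n+1) * (s n).q → ∀ P, dist ((s n).T.F^[j] P) (A.F^[j] P) ≤ 2 * (1/2)^n)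
    (Z : ℕ → Set Torus2)
    (hZ : ∀ n, ∀ P, torusProj P ∉ Z n → ∀ g : ℝ × ℝ → ℝ, Continuous g → (∀ x, |g x| ≤ 1) →
    (∀ a b, |g a - g b| ≤ (s n).ell * dist a b) →
    |(∫ x in (0:ℝ)..1, g ((s (n+1)).H.F (x, ((s (n+1)).H.G P).2))) - ∫ x in (0:ℝ)..1, g ((s n).H.F (x, ((s n).H.G P).2))| ≤
      (1/2) ^ (n + 4))
    (P : ℝ × ℝ) (hP : IsGenericPt (toDiffeo A).toEquiv volume (torusProj P)) (k : ℕ) :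
    ∃ n ≥ k, torusProj P ∈ Z n := by
  by_contra hcon
  push Not at hcon
  rw [generic_iff] at hP
  set yk := ((s k).H.G P).2 with hyk
  set f0 : ℝ × ℝ → ℝ := fun Q => Real.cos (2 * Real.pi * (Q.2 - yk)) with hf0
  have f0c : Continuous f0 := by fun_prop
  have f0p : Per f0 := by
    intro p m
    simp only [hf0]
    rw [← Real.cos_add_int_mul_two_pi (2 * Real.pi * (p.2 - yk)) m.2]
    congr 1
    simp; ring
  set g : ℝ × ℝ → ℝ := fun Q => f0 ((s k).H.G Q) with hg
  have gc : Continuous g := f0c.comp (s k).H.hG.continuous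
  have gp : Per g := f0p.comp (s k).H.eG
  have g1 : ∀ x, |g x| ≤ 1 := fun x => Real.abs_cos_le_one _
  have gI : I2 g = 0 := by
    rw [hg, I2_G _ f0 f0c f0p]
    unfold I2
    simp only [hf0, int_cos_shift]
    simp
  have hell0 : 0 ≤ (s k).ell := by linarith [(s k).hell, (s k).hL1]
  have gl : ∀ a b, |g a - g b| ≤ (s k).ell * dist a b := by
    intro a b
    refine (Real.abs_cos_sub_cos_le _ _).trans ?_
    have h1 : |((s k).H.G a).2 - ((s k).H.G b).2| ≤ (s k).L * dist a b :=
      le_trans (le_max_right (dist ((s k).H.G a).1 ((s k).H.G b).1) (dist ((s k).H.G a).2 ((s k).H.G b).2)) ((s k).lG a b)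
    have h2 : 2 * Real.pi * (((s k).H.G a).2 - yk) - 2 * Real.pi * (((s k).H.G b).2 - yk) =
      2 * Real.pi * (((s k).H.G a).2 - ((s k).H.G b).2) := by ring
    rw [h2, abs_mul, abs_of_pos (by positivity)]
    have h3 : 2 * Real.pi ≤ 7 := by linarith [Real.pi_lt_d2]
    calc 2 * Real.pi * |((s k).H.G a).2 - ((s k).H.G b).2| ≤ 7 * ((s k).L * dist a b) := by gcongr
      _ = 7 * (s k).L * dist a b := by ring
      _ ≤ _ := by gcongr; exact (s k).hell
  have ellm : ∀ n ≥ k, (s k).ell ≤ (s n).ell := by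
    intro n hn
    induction n, hn using Nat.le_induction with
    | base => exact le_rfl
    | succ n hn ih => exact ih.trans (hs n).ell
  set Γ : ℕ → ℝ := fun n => ∫ x in (0:ℝ)..1, g ((s n).H.F (x, ((s n).H.G P).2)) with hΓ
  have hΓb : ∀ n ≥ k, 7/8 + (1/2)^(n+3) ≤ Γ n := by
    intro n hn
    induction n, hn using Nat.le_induction with
    | base =>
      have e : Γ k = 1 := by
        simp only [hΓ, hg, (s k).H.GF, hf0, ← hyk, sub_self, mul_zero, Real.cos_zero]
        simp
      rw [e, pow_add]
      have : (1/2:ℝ)^k ≤ 1 := pow_le_one₀ (by norm_num) (by norm_num)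
      norm_num at this ⊢
      linarith
    | succ n hn ih =>
      have := hZ n P (hcon n hn) g gc g1 (fun a b => (gl a b).trans
        (mul_le_mul_of_nonneg_right (ellm n hn) dist_nonneg))
      have h1 := (abs_le.1 this).1
      have e : (1/2:ℝ)^(n+3) = 2 * (1/2)^(n+4) := by ring
      have e2 : (1/2:ℝ)^(n+1+3) = (1/2)^(n+4) := by ring
      rw [e2]
      rw [e] at ih
      change _ ≤ Γ n at ih
      change -(1/2:ℝ)^(n+4) ≤ Γ (n+1) - Γ n at h1
      linarith
  have hclose : ∀ n, |((s n).q:ℝ)⁻¹ * (∑ j ∈ Finset.range (s n).q, g (A.F^[j] P)) - Γ n| ≤ 3 * (s k).ell * (1/2)^n := by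
    intro n
    have hp : (0:ℝ) < (1/2)^n := by positivity
    have c1 := riemann_coprime (fun x => g ((s n).H.F (x, ((s n).H.G P).2)))
      (gc.comp ((s n).H.hF.continuous.comp (by fun_prop)))
      ((gp.comp (s n).H.eF).fst _) (s n).q (s n).p (s n).hq (s n).hpq ((s k).ell * (1/2)^n) (by
        intro a b hab
        refine (gl _ _).trans (mul_le_mul_of_nonneg_left ?_ hell0)
        refine ((s n).lF _ _).trans ?_
        rw [dist_pair, sub_self, abs_zero, max_eq_left (abs_nonneg _)]
        refine le_trans ?_ (stage_pow_le s h0 hs n)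
        have hL0 : 0 ≤ (s n).L := by linarith [(s n).hL1]
        calc (s n).L * |a - b| ≤ (s n).L * (1 / (s n).q) := by gcongr
          _ = _ := by ring) ((s n).H.G P).1
    have c2 := avg_close (s n).q (fun j => g (A.F^[j] P)) (fun j => g ((s n).T.F^[j] P)) ((s k).ell * (2 * (1/2)^n))
      (by positivity) (fun j hj => by
        rw [abs_sub_comm]
        refine (gl _ _).trans (mul_le_mul_of_nonneg_left (hA n j ?_ P) hell0)
        have : (s n).q ≤ 2^(n+1) * (s n).q := Nat.le_mul_of_pos_left _ (by positivity)
        omega)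
    have e : ∀ j : ℕ, g ((s n).T.F^[j] P) = g ((s n).H.F (((s n).H.G P).1 + j * ((s n).p / (s n).q), ((s n).H.G P).2)) := by
      intro j
      rw [Stage.T, cnj_iter]
      congr 2
      ext <;> simp [Stage.al]
    simp only [← e] at c1
    rw [one_div] at c1
    have := (abs_sub_le _ _ _).trans (add_le_add c2 c1)
    refine this.trans (le_of_eq ?_)
    ring
  have hqn : ∀ n, n ≤ (s n).q := by
    intro n
    have h1 := stage_pow_le s h0 hs n
    have hq : (0:ℝ) < (s n).q := by exact_mod_cast (s n).hq
    rw [div_le_iff₀ hq] at h1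
    have h2 : (2:ℝ)^n * (1/2)^n = 1 := by rw [← mul_pow]; norm_num
    have h3 : (2:ℝ)^n ≤ (s n).q := by
      have : (2:ℝ)^n * 1 ≤ 2^n * ((1/2)^n * (s n).q) := by
        gcongr; linarith [(s n).hL1]
      rw [← mul_assoc, h2] at this
      linarith
    have h4 : 2^n ≤ (s n).q := by exact_mod_cast h3
    exact (Nat.lt_two_pow_self.le).trans h4
  have hqt : Tendsto (fun n => (s n).q) atTop atTop := tendsto_atTop_mono hqn tendsto_id
  have ht := (hP g gc gp).comp hqt
  rw [gI] at ht
  have ht2 : Tendsto (fun n : ℕ => 3 * (s k).ell * (1/2:ℝ)^n) atTop (𝓝 0) := by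
    simpa using (tendsto_pow_atTop_nhds_zero_of_lt_one (by norm_num : (0:ℝ) ≤ 1/2) (by norm_num)).const_mul (3 * (s k).ell)
  obtain ⟨n, hn1, hn2, hn3⟩ := ((ht.eventually (gt_mem_nhds (by norm_num : (0:ℝ) < 1/4))).and
    ((ht2.eventually (gt_mem_nhds (by norm_num : (0:ℝ) < 1/4))).and (eventually_ge_atTop k))).exists
  have b1 := hΓb n hn3
  have b2 := (abs_le.1 (hclose n)).1
  have hp : (0:ℝ) < (1/2)^(n+3) := by positivity
  simp only [Function.comp] at hn1
  linarith

lemma cov_vol (n : ℕ) (Z : Set Torus2) (h : Cov n Z) : volume Z ≤ ENNReal.ofReal (4 * (1/2)^n) := by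
  obtain ⟨N, ρ, c, hρ, hρn, hN, hZ, hc⟩ := h
  have h1 : ∀ i, volume (c i) ≤ ENNReal.ofReal (4 * ρ^3) := by
    intro i
    rcases (c i).eq_empty_or_nonempty with he | ⟨x, hx⟩
    · rw [he]; simp
    have hsub : c i ⊆ Metric.closedBall x.1 (ρ^2) ×ˢ Metric.closedBall x.2 (ρ^2) := by
      intro y hy
      have := hc i y hy x hx
      rw [Prod.dist_eq, max_le_iff] at this
      exact this
    refine (measure_mono hsub).trans ?_
    change ((volume : Measure UnitAddCircle).prod (volume : Measure UnitAddCircle)) _ ≤ _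
    rw [Measure.prod_prod]
    have e : ∀ z : UnitAddCircle, volume (Metric.closedBall z (ρ^2)) ≤ ENNReal.ofReal (2 * ρ^2) := by
      intro z
      rw [AddCircle.volume_closedBall]
      exact ENNReal.ofReal_le_ofReal (min_le_right _ _)
    refine (mul_le_mul' (e _) (e _)).trans ?_
    rw [← ENNReal.ofReal_mul (by positivity)]
    apply ENNReal.ofReal_le_ofReal
    have hρ1 : ρ ≤ 1 := hρn.trans (pow_le_one₀ (by norm_num) (by norm_num))
    have : 0 < ρ^3 := by positivity
    nlinarith
  calc volume Z ≤ volume (⋃ i, c i) := measure_mono hZ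
    _ ≤ ∑' i, volume (c i) := measure_iUnion_le _
    _ = ∑ i, volume (c i) := tsum_fintype _
    _ ≤ ∑ i : Fin N, ENNReal.ofReal (4 * ρ^3) := Finset.sum_le_sum (fun i _ => h1 i)
    _ = N * ENNReal.ofReal (4 * ρ^3) := by simp
    _ = ENNReal.ofReal (N * (4 * ρ^3)) := by rw [ENNReal.ofReal_mul (p := (N:ℝ)) (by positivity), ENNReal.ofReal_natCast]
    _ ≤ _ := ENNReal.ofReal_le_ofReal (by linarith)

lemma limsup_null (Z : ℕ → Set Torus2) (hZ : ∀ n, Cov n (Z n)) (B : Set Torus2)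
    (hB : ∀ x ∈ B, ∀ k, ∃ n ≥ k, x ∈ Z n) : volume B = 0 := by
  have h1 : ∑' n, volume (Z n) ≠ ⊤ := by
    refine ne_top_of_le_ne_top ?_ (ENNReal.tsum_le_tsum (fun n => cov_vol n (Z n) (hZ n)))
    rw [← ENNReal.ofReal_tsum_of_nonneg (fun n => by positivity) (summable_geometric_two.mul_left _)]
    exact ENNReal.ofReal_ne_top
  refine measure_mono_null ?_ (measure_limsup_atTop_eq_zero h1)
  intro x hx
  rw [mem_limsup_iff_frequently_mem, frequently_atTop]
  exact hB x hx

lemma limsup_dim (Z : ℕ → Set Torus2) (hZ : ∀ n, Cov n (Z n)) (B : Set Torus2)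
    (hB : ∀ x ∈ B, ∀ k, ∃ n ≥ k, x ∈ Z n) : dimH B ≤ ENNReal.ofReal (3/2) := by
  choose N ρ c hρ hρn hN hZc hc using hZ
  have hdiam : ∀ n i, Metric.ediam (c n i) ≤ ENNReal.ofReal (ρ n ^ 2) := by
    intro n i
    apply Metric.ediam_le
    intro x hx y hy
    rw [edist_dist]
    exact ENNReal.ofReal_le_ofReal (hc n i x hx y hy)
  have hρ1 : ∀ n, ρ n ≤ 1 := fun n => (hρn n).trans (pow_le_one₀ (by norm_num) (by norm_num))
  have hr : Tendsto (fun k : ℕ => ENNReal.ofReal ((1/2)^k)) atTop (𝓝 0) := by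
    have := ENNReal.tendsto_ofReal (tendsto_pow_atTop_nhds_zero_of_lt_one (by norm_num : (0:ℝ) ≤ 1/2) (by norm_num))
    simpa using this
  have hm := Measure.hausdorffMeasure_le_liminf_tsum (ι := fun k : ℕ => Σ n : ℕ, Fin (N (k + n))) (3/2) B
    (l := atTop) (fun k : ℕ => ENNReal.ofReal ((1/2)^k)) hr (fun k i => c (k + i.1) i.2)
    (Eventually.of_forall (fun k i => (hdiam _ _).trans (ENNReal.ofReal_le_ofReal (by
      have a1 := hρn (k + i.1)
      have a2 : (1/2:ℝ)^(k+i.1) ≤ (1/2)^k := pow_le_pow_of_le_one (by norm_num) (by norm_num) (by omega)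
      have := hρ1 (k + i.1)
      have := hρ (k + i.1)
      nlinarith))))
    (Eventually.of_forall (fun k x hx => by
      obtain ⟨n, hn, hxn⟩ := hB x hx k
      obtain ⟨j, rfl⟩ : ∃ j, n = k + j := ⟨n - k, by omega⟩
      obtain ⟨i, hi⟩ := Set.mem_iUnion.1 (hZc _ hxn)
      exact Set.mem_iUnion.2 ⟨⟨j, i⟩, hi⟩))
  have hsum : ∀ k : ℕ, ∑' i : (Σ n : ℕ, Fin (N (k + n))), Metric.ediam (c (k + i.1) i.2) ^ (3/2 : ℝ) ≤ 2 := by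
    intro k
    rw [ENNReal.tsum_sigma' (β := fun n => Fin (N (k + n)))]
    calc ∑' n, ∑' i : Fin (N (k + n)), Metric.ediam (c (k + n) i) ^ (3/2 : ℝ)
        ≤ ∑' n : ℕ, ENNReal.ofReal ((1/2)^n) := by
          refine ENNReal.tsum_le_tsum (fun n => ?_)
          rw [tsum_fintype]
          have e : ∀ i ∈ Finset.univ, Metric.ediam (c (k + n) i) ^ (3/2 : ℝ) ≤ ENNReal.ofReal (ρ (k+n) ^ 3) := by
            intro i _
            refine (ENNReal.rpow_le_rpow (hdiam _ _) (by norm_num)).trans ?_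
            rw [ENNReal.ofReal_rpow_of_nonneg (by positivity) (by norm_num), ← Real.rpow_natCast,
              ← Real.rpow_mul (hρ _).le, ← Real.rpow_natCast]
            norm_num
          refine (Finset.sum_le_sum e).trans ?_
          rw [Finset.sum_const, Finset.card_univ, Fintype.card_fin, nsmul_eq_mul, ← ENNReal.ofReal_natCast,
            ← ENNReal.ofReal_mul (by positivity)]
          apply ENNReal.ofReal_le_ofReal
          refine (hN _).trans (pow_le_pow_of_le_one (by norm_num) (by norm_num) (by omega))
      _ = 2 := by
        rw [← ENNReal.ofReal_tsum_of_nonneg (fun n => by positivity) summable_geometric_two, tsum_geometric_two]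
        simp
  have hfin : μH[(3/2:ℝ)] B ≤ 2 := by
    refine hm.trans ?_
    refine liminf_le_of_le (by isBoundedDefault) ?_
    intro b hb
    obtain ⟨k, hk⟩ := hb.exists
    exact hk.trans (hsum k)
  have := dimH_le_of_hausdorffMeasure_ne_top (s := B) (d := Real.toNNReal (3/2)) (by
    rw [Real.coe_toNNReal _ (by norm_num)]
    exact ne_top_of_le_ne_top (by simp) hfin)
  exact this

lemma log_half : 1/2 ≤ Real.log 2 / Real.log 3 := by
  have h3 : 0 < Real.log 3 := Real.log_pos (by norm_num)
  rw [le_div_iff₀ h3]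
  have : Real.log 3 ≤ Real.log (2^2) := Real.log_le_log (by norm_num) (by norm_num)
  rw [Real.log_pow] at this
  push_cast at this
  linarith

lemma log_one : Real.log 2 / Real.log 3 ≤ 1 := by
  have h3 : 0 < Real.log 3 := Real.log_pos (by norm_num)
  rw [div_le_one h3]
  exact Real.log_le_log (by norm_num) (by norm_num)

/-- **Theorem C.** There is a C^∞ μ-preserving diffeomorphism `T` of `𝕋²` such that the set
`B` of all generic points of `T` for the Lebesgue measure `μ` satisfies
`log 2 / log 3 ≤ dim_H B ≤ 1 + log 2 / log 3` and `μ(B) = 0`. -/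
theorem generic_points_hausdorff_dim_cantor :
    ∃ T : SmoothMPTorusDiffeo,
      ENNReal.ofReal (Real.log 2 / Real.log 3) ≤
          dimH {x : Torus2 | IsGenericPt T.toEquiv volume x} ∧
      dimH {x : Torus2 | IsGenericPt T.toEquiv volume x} ≤
          1 + ENNReal.ofReal (Real.log 2 / Real.log 3) ∧
      volume {x : Torus2 | IsGenericPt T.toEquiv volume x} = 0 := by
  obtain ⟨s, h0, hs⟩ := exists_seq
  obtain ⟨A, hA⟩ := exists_limit s hs
  choose Z hZc hZ using fun n => (hs n).bad
  have hB : ∀ x ∈ {x : Torus2 | IsGenericPt (toDiffeo A).toEquiv volume x}, ∀ k, ∃ n ≥ k, x ∈ Z n := by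
    intro x hx k
    obtain ⟨P, rfl⟩ := torusProj_quot.surjective x
    exact generic_bad s h0 hs A hA Z hZ P hx k
  refine ⟨toDiffeo A, ?_, ?_, limsup_null Z hZc _ hB⟩
  · refine le_trans ?_ (lower_bound s h0 hs A hA)
    rw [← ENNReal.ofReal_one]
    exact ENNReal.ofReal_le_ofReal log_one
  · refine (limsup_dim Z hZc _ hB).trans ?_
    rw [← ENNReal.ofReal_one, ← ENNReal.ofReal_add zero_le_one (by linarith [log_half])]
    exact ENNReal.ofReal_le_ofReal (by linarith [log_half])
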